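/- arXiv:2308.07256 — 3 statements merged into one kernel-verified Lean document; each statement's English description precedes it below -/
import Mathlib

section
/- Let n, d, r be positive integers and suppose π, π' ∈ OP(n,d,r) have the same underlying unordered set partition, so that π' = σ(π) for some permutation σ of {1,…,d} (where σ(π)_i = π_{σ^{-1}(i)}). Then [π]_r = sgn(σ)^r · [π']_r. In particular, when r is even the r-jellyfish invariant depends only on the underlying unordered set partition. -/
open scoped Classical

namespace Jellyfish

/-- A tableau with `ν` rows and `d` columns, whose cells are either empty or
contain an element of `Fin n`. -/
abbrev Tab (ν n d : ℕ) := Fin ν → Fin d → Option (Fin n)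

/-- `π` is an ordered set partition of `[n]` into `d` blocks, each of size at least `r`:
blocks are pairwise disjoint with union `[n]` and cardinality at least `r`. -/
def IsOSP (n d r : ℕ) (π : Fin d → Finset (Fin n)) : Prop :=
  (∀ j, r ≤ (π j).card) ∧
  (∀ j k, j ≠ k → Disjoint (π j) (π k)) ∧
  (Finset.univ.biUnion π = Finset.univ)

/-- The nonempty entries of column `j` of `T`, read from top to bottom. -/
def colList {ν n d : ℕ} (T : Tab ν n d) (j : Fin d) : List (Fin n) :=
  (List.finRange ν).filterMap (fun i => T i j)

/-- `T` is an `r`-jellyfish tableau for `π`: it has `n - (d-1)r` rows and `d` columns,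
every cell in the first `r` rows is nonempty, every lower row has exactly one nonempty
cell, and the nonempty entries of column `j`, top to bottom, are exactly the elements
of `π j` in increasing order. -/
def IsJelly (n d r : ℕ) (π : Fin d → Finset (Fin n)) (T : Tab (n - (d-1)*r) n d) : Prop :=
  (∀ i : Fin (n - (d-1)*r), (i : ℕ) < r → ∀ j, (T i j).isSome) ∧
  (∀ i : Fin (n - (d-1)*r), r ≤ (i : ℕ) → ∃! j, (T i j).isSome) ∧
  (∀ j, colList T j = (π j).sort (· ≤ ·))

/-- The row reading word of `T` (rows top to bottom, each row left to right), with
each entry tagged by its column index. -/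
def cells {ν n d : ℕ} (T : Tab ν n d) : List (Fin d × Fin n) :=
  (List.finRange ν).flatMap (fun i =>
    (List.finRange d).filterMap (fun j => (T i j).map (fun v => (j, v))))

/-- The number of inversions of a (column-tagged) word: pairs of positions `p < q`
whose values are inverted. -/
def invList {n d : ℕ} : List (Fin d × Fin n) → ℕ
  | [] => 0
  | a :: l => l.countP (fun b => decide (b.2 < a.2)) + invList l

/-- The number of inversions of a (column-tagged) word that do not involve two
entries lying in the same column. -/
def invList' {n d : ℕ} : List (Fin d × Fin n) → ℕ
  | [] => 0
  | a :: l => l.countP (fun b => decide (b.2 < a.2 ∧ b.1 ≠ a.1)) + invList' l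

/-- The sign `(-1)^(inv T)` of a tableau, where `inv T` counts all inversions of the
row reading word. -/
def tabSign {ν n d : ℕ} (T : Tab ν n d) : ℤ := (-1) ^ invList (cells T)

/-- The sign `(-1)^(inv T)` of a (column-permuted) tableau, where inversions within a
single column are not counted. -/
def tabSign' {ν n d : ℕ} (T : Tab ν n d) : ℤ := (-1) ^ invList' (cells T)

/-- The minor `M_I^J` of the `ν × n` matrix of indeterminates `x_{ij}`: the determinant
of the submatrix with rows `I` and columns `J`, each taken in increasing order
(and `0` if `|I| ≠ |J|`). -/
noncomputable def minor (ν n : ℕ) (I : Finset (Fin ν)) (J : Finset (Fin n)) :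
    MvPolynomial (Fin ν × Fin n) ℂ :=
  if h : I.card = J.card then
    Matrix.det (Matrix.of fun a b : Fin I.card =>
      MvPolynomial.X (I.orderEmbOfFin rfl a, J.orderEmbOfFin h.symm b))
  else 0

/-- The set `R_j(T)` of rows of `T` containing an entry of block `j`. -/
def rowsUsed {ν n d : ℕ} (T : Tab ν n d) (j : Fin d) : Finset (Fin ν) :=
  Finset.univ.filter (fun i => (T i j).isSome)

/-- The product of minors `J(T) = ∏_j M_{R_j(T)}^{π_j}`. -/
noncomputable def JProd {ν n d : ℕ} (π : Fin d → Finset (Fin n)) (T : Tab ν n d) :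
    MvPolynomial (Fin ν × Fin n) ℂ :=
  ∏ j : Fin d, minor ν n (rowsUsed T j) (π j)

/-- The `r`-jellyfish invariant `[π]_r = Σ_{T ∈ J_r(π)} sgn(T)·J(T)`. -/
noncomputable def jellyInv (n d r : ℕ) (π : Fin d → Finset (Fin n)) :
    MvPolynomial (Fin (n - (d-1)*r) × Fin n) ℂ :=
  ∑ T : Tab (n - (d-1)*r) n d,
    if IsJelly n d r π T then (tabSign T : ℂ) • JProd π T else 0


/-- Permute the columns of `T` according to `σ`: column `j` of the result is
column `σ⁻¹ j` of `T`. -/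
def colPerm {ν n d : ℕ} (σ : Equiv.Perm (Fin d)) (T : Tab ν n d) : Tab ν n d :=
  fun i j => T i (σ⁻¹ j)

/-- The top `k` rows of a tableau with `ν` rows. -/
def topRows (ν k : ℕ) : Finset (Fin ν) := Finset.univ.filter (fun i => (i : ℕ) < k)

/-- The top-justified minor `p_J`, using rows `1, …, |J|` and the columns in `J`
(in increasing order). -/
noncomputable def topMinor (ν n : ℕ) (J : Finset (Fin n)) :
    MvPolynomial (Fin ν × Fin n) ℂ :=
  minor ν n (topRows ν J.card) J

/-- The spanning set of the flamingo Specht module `S^{(d^r, 1^{n-rd})}`: all products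
`∏_i p_{J_i}` over tuples `(J_1, …, J_d)` of pairwise disjoint subsets of `[n]` with
union `[n]`, `|J_1| = n-(d-1)r` and `|J_i| = r` for `i ≥ 2`. -/
def flamingoSet (n d r : ℕ) : Set (MvPolynomial (Fin (n - (d-1)*r) × Fin n) ℂ) :=
  { f | ∃ Js : Fin d → Finset (Fin n),
      (∀ i j, i ≠ j → Disjoint (Js i) (Js j)) ∧
      (Finset.univ.biUnion Js = Finset.univ) ∧
      (∀ i : Fin d, (i : ℕ) = 0 → (Js i).card = n - (d-1)*r) ∧
      (∀ i : Fin d, (i : ℕ) ≠ 0 → (Js i).card = r) ∧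
      f = ∏ i : Fin d, topMinor (n - (d-1)*r) n (Js i) }

/-- `P` is an (unordered) set partition of `[n]`: a collection of pairwise disjoint
nonempty blocks whose union is `[n]`. -/
def IsUPartition (n : ℕ) (P : Finset (Finset (Fin n))) : Prop :=
  (∀ B ∈ P, B.Nonempty) ∧
  (∀ B1 ∈ P, ∀ B2 ∈ P, B1 ≠ B2 → Disjoint B1 B2) ∧
  (∀ x : Fin n, ∃ B ∈ P, x ∈ B)

/-- `P` is noncrossing: there do not exist `a < b < c < e` with `a, c` in one block
and `b, e` in a different block. -/
def IsNoncrossing (n : ℕ) (P : Finset (Finset (Fin n))) : Prop :=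
  ∀ a b c e : Fin n, a < b → b < c → c < e →
    ∀ B1 ∈ P, ∀ B2 ∈ P, a ∈ B1 → c ∈ B1 → b ∈ B2 → e ∈ B2 → B1 = B2

/-- `P` is a noncrossing set partition of `[n]` into `d` blocks, each of size at
least `r` (the set `NC(n,d,r)`). -/
def IsNCPartition (n d r : ℕ) (P : Finset (Finset (Fin n))) : Prop :=
  IsUPartition n P ∧ IsNoncrossing n P ∧ P.card = d ∧ ∀ B ∈ P, r ≤ B.card

/-- The set of smallest elements of the blocks of an ordered set partition. -/
def blockMinima (n d : ℕ) (π : Fin d → Finset (Fin n)) : Finset (Fin n) :=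
  Finset.univ.filter (fun x => ∃ j, x ∈ π j ∧ ∀ y ∈ π j, x ≤ y)

/-- The set of smallest elements (block minima) of an unordered set partition. -/
def blockMinimaU (n : ℕ) (P : Finset (Finset (Fin n))) : Finset (Fin n) :=
  Finset.univ.filter (fun x => ∃ B ∈ P, x ∈ B ∧ ∀ y ∈ B, x ≤ y)

/-- The set of largest elements (block maxima) of an unordered set partition. -/
def blockMaximaU (n : ℕ) (P : Finset (Finset (Fin n))) : Finset (Fin n) :=
  Finset.univ.filter (fun x => ∃ B ∈ P, x ∈ B ∧ ∀ y ∈ B, y ≤ x)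

/-- The number of inversions of a word. -/
def inversions {n : ℕ} : List (Fin n) → ℕ
  | [] => 0
  | a :: l => l.countP (fun b => decide (b < a)) + inversions l

/-- The number of inversions between a letter of `l` and a letter of `l'` in `l ++ l'`. -/
def crossInversions {n : ℕ} (l l' : List (Fin n)) : ℕ :=
  (l.map fun a => l'.countP (fun b => decide (b < a))).sum

theorem invList_eq_inversions {n d : ℕ} (l : List (Fin d × Fin n)) :
    invList l = inversions (l.map Prod.snd) := by
  induction l with
  | nil => rfl
  | cons a l ih => simp [invList, inversions, ih, List.countP_map, Function.comp_def]

theorem inversions_append {n : ℕ} (l l' : List (Fin n)) :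
    inversions (l ++ l') = inversions l + inversions l' + crossInversions l l' := by
  induction l with
  | nil => simp [inversions, crossInversions]
  | cons a l ih =>
    simp only [crossInversions] at ih
    simp only [List.cons_append, inversions, crossInversions, List.countP_append, ih,
      List.map_cons, List.sum_cons]
    ring

theorem crossInversions_perm {n : ℕ} {l₁ l₂ l₁' l₂' : List (Fin n)}
    (h : l₁.Perm l₂) (h' : l₁'.Perm l₂') :
    crossInversions l₁ l₁' = crossInversions l₂ l₂' := by
  unfold crossInversions
  rw [(h.map _).sum_eq]
  simp_rw [h'.countP_eq]

theorem neg_one_pow_inversions_flatMap {n : ℕ} {ι : Type*} (L : List ι)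
    (f g : ι → List (Fin n)) (c : ι → ℤ) (hp : ∀ i, (f i).Perm (g i))
    (hs : ∀ i, (-1 : ℤ) ^ inversions (f i) = c i * (-1) ^ inversions (g i)) :
    (-1 : ℤ) ^ inversions (L.flatMap f) =
      (L.map c).prod * (-1) ^ inversions (L.flatMap g) := by
  induction L with
  | nil => simp
  | cons a L ih =>
    have hL : (L.flatMap f).Perm (L.flatMap g) := List.Perm.flatMap_left _ fun i _ => hp i
    simp only [List.flatMap_cons, inversions_append, pow_add, hs, ih, List.map_cons,
      List.prod_cons, crossInversions_perm (hp a) hL]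
    ring

/-- The sign of the pair of letters `a`, `b` in this order. -/
def pairSign {n : ℕ} (a b : Fin n) : ℤ :=
  if a < b then 1 else if b < a then -1 else 0

theorem neg_one_pow_inversions_ofFn {n d : ℕ} (v : Fin d → Fin n)
    (hv : Function.Injective v) :
    (-1 : ℤ) ^ inversions (List.ofFn v) =
      ∏ i, ∏ j ∈ Finset.Ioi i, pairSign (v i) (v j) := by
  induction d with
  | zero => simp [inversions]
  | succ d ih =>
    have hcount : ∀ l : List (Fin n), (∀ b ∈ l, b ≠ v 0) →
        (-1 : ℤ) ^ l.countP (fun b => decide (b < v 0)) =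
          (l.map (pairSign (v 0))).prod := by
      intro l
      induction l with
      | nil => simp
      | cons b l ihl =>
        intro hl
        rw [List.forall_mem_cons] at hl
        rw [List.map_cons, List.prod_cons, ← ihl hl.2, List.countP_cons, pow_add]
        rcases lt_or_gt_of_ne hl.1 with h | h
        · simp [pairSign, h, h.not_gt]
        · simp [pairSign, h, h.not_gt]
    have htail : Function.Injective fun i : Fin d => v i.succ :=
      hv.comp (Fin.succ_injective d)
    rw [List.ofFn_succ, inversions, pow_add, ih _ htail, Fin.prod_univ_succ,
      Fin.prod_Ioi_zero, hcount]
    · simp [List.map_ofFn, List.prod_ofFn, Fin.prod_Ioi_succ]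
    · intro b hb
      obtain ⟨i, rfl⟩ := (List.mem_ofFn' _ _).1 hb
      exact fun h => Fin.succ_ne_zero i (hv h)

theorem neg_one_pow_inversions_ofFn_comp {n d : ℕ} (v : Fin d → Fin n)
    (hv : Function.Injective v) (σ : Equiv.Perm (Fin d)) :
    (-1 : ℤ) ^ inversions (List.ofFn fun j => v (σ j)) =
      Equiv.Perm.sign σ * (-1) ^ inversions (List.ofFn v) := by
  rw [neg_one_pow_inversions_ofFn (fun j => v (σ j)) (hv.comp σ.injective),
    neg_one_pow_inversions_ofFn v hv]
  have hanti : ∀ i j, pairSign (v i) (v j) = -pairSign (v j) (v i) := by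
    intro i j
    simp only [pairSign]
    split_ifs <;> first | rfl | omega
  simpa using σ.prod_Ioi_comp_eq_sign_mul_prod hanti

/-- The nonempty entries of row `i` of `T`, read from left to right. -/
def rowList {ν n d : ℕ} (T : Tab ν n d) (i : Fin ν) : List (Fin n) :=
  (List.finRange d).filterMap (T i)

theorem tabSign_eq {ν n d : ℕ} (T : Tab ν n d) :
    tabSign T = (-1) ^ inversions ((List.finRange ν).flatMap (rowList T)) := by
  have hrow : ∀ i, ((List.finRange d).filterMap
      fun j => (T i j).map (fun v => (j, v))).map Prod.snd = rowList T i := by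
    intro i
    simp [rowList, List.map_filterMap, Option.map_map, Function.comp_def]
  rw [tabSign, invList_eq_inversions, cells, List.map_flatMap]
  simp_rw [hrow]

theorem rowList_colPerm_perm {ν n d : ℕ} (σ : Equiv.Perm (Fin d)) (T : Tab ν n d)
    (i : Fin ν) : (rowList (colPerm σ T) i).Perm (rowList T i) := by
  have h : rowList (colPerm σ T) i =
      ((List.finRange d).map ⇑(σ⁻¹)).filterMap (T i) := by
    rw [List.filterMap_map]; rfl
  rw [h]
  exact (Equiv.Perm.map_finRange_perm σ⁻¹).filterMap _

theorem rowList_eq_ofFn {ν n d : ℕ} (T : Tab ν n d) (i : Fin ν) (v : Fin d → Fin n)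
    (h : ∀ j, T i j = some (v j)) : rowList T i = List.ofFn v := by
  have : T i = some ∘ v := funext h
  rw [rowList, this, List.filterMap_eq_map, List.ofFn_eq_map]

theorem IsJelly.mem_block {n d r : ℕ} {π : Fin d → Finset (Fin n)}
    {T : Tab (n - (d-1)*r) n d} (hT : IsJelly n d r π T) {i : Fin (n - (d-1)*r)}
    {j : Fin d} {a : Fin n} (h : T i j = some a) : a ∈ π j := by
  have : a ∈ colList T j := List.mem_filterMap.2 ⟨i, List.mem_finRange i, h⟩
  rw [hT.2.2 j] at this
  simpa using this

theorem IsOSP.le_rows {n d r : ℕ} {π : Fin d → Finset (Fin n)} (hπ : IsOSP n d r π)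
    (hd : 0 < d) : r ≤ n - (d-1)*r := by
  have hcard : n = ∑ j, (π j).card := by
    rw [← Finset.card_biUnion fun i _ j _ h => hπ.2.1 i j h, hπ.2.2, Finset.card_univ,
      Fintype.card_fin]
  have hle : d * r ≤ n := by
    rw [hcard]
    simpa using Finset.card_nsmul_le_sum Finset.univ (fun j => (π j).card) r
      fun j _ => hπ.1 j
  obtain ⟨e, rfl⟩ := Nat.exists_eq_succ_of_ne_zero hd.ne'
  rw [Nat.succ_mul] at hle
  simp only [Nat.succ_eq_add_one, Nat.add_sub_cancel]
  omega

theorem tabSign_colPerm {n d r : ℕ} {π : Fin d → Finset (Fin n)} (hπ : IsOSP n d r π)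
    (hd : 0 < d) {T : Tab (n - (d-1)*r) n d} (hT : IsJelly n d r π T)
    (σ : Equiv.Perm (Fin d)) :
    tabSign (colPerm σ T) = (Equiv.Perm.sign σ : ℤ) ^ r * tabSign T := by
  rw [tabSign_eq, tabSign_eq, neg_one_pow_inversions_flatMap (List.finRange _)
    (rowList (colPerm σ T)) (rowList T)
    (fun i => if (i : ℕ) < r then (Equiv.Perm.sign σ : ℤ) else 1)
    (rowList_colPerm_perm σ T)]
  · congr 1
    rw [← List.ofFn_eq_map, List.prod_ofFn, Finset.prod_ite, Finset.prod_const,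
      Finset.prod_const_one, mul_one]
    congr 1
    rw [Fin.card_filter_val_lt]
    exact min_eq_right (hπ.le_rows hd)
  · intro i
    split_ifs with hi
    · choose v hv using fun j => Option.isSome_iff_exists.1 (hT.1 i hi j)
      have hinj : Function.Injective v := by
        intro j k hjk
        by_contra hne
        exact Finset.disjoint_left.1 (hπ.2.1 j k hne) (hT.mem_block (hv j))
          (hjk ▸ hT.mem_block (hv k))
      rw [rowList_eq_ofFn T i v hv, rowList_eq_ofFn (colPerm σ T) i (fun j => v (σ⁻¹ j))
        fun j => hv _, neg_one_pow_inversions_ofFn_comp v hinj, Equiv.Perm.sign_inv]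
    · obtain ⟨j, hj, huniq⟩ := hT.2.1 i (not_lt.1 hi)
      have hlen : (rowList T i).length ≤ 1 := by
        rw [rowList, List.length_filterMap_eq_countP]
        refine le_trans (List.countP_mono_left (q := (· == j)) fun k _ hk => ?_)
          (List.nodup_iff_count_le_one.1 (List.nodup_finRange d) j)
        simpa using huniq k hk
      have hperm := rowList_colPerm_perm σ T i
      rcases h : rowList T i with _ | ⟨a, _ | ⟨b, l⟩⟩
      · rw [h] at hperm; simp [hperm.eq_nil]
      · rw [h] at hperm; simp [List.perm_singleton.1 hperm]
      · simp [h] at hlen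

/-- Permuting columns is a bijection on tableaux. -/
def colPermEquiv (ν n : ℕ) {d : ℕ} (σ : Equiv.Perm (Fin d)) : Tab ν n d ≃ Tab ν n d where
  toFun := colPerm σ
  invFun := colPerm σ⁻¹
  left_inv T := by ext1 i; ext1 j; simp [colPerm]
  right_inv T := by ext1 i; ext1 j; simp [colPerm]

theorem IsJelly.colPerm {n d r : ℕ} {π : Fin d → Finset (Fin n)}
    {T : Tab (n - (d-1)*r) n d} (hT : IsJelly n d r π T) (σ : Equiv.Perm (Fin d)) :
    IsJelly n d r (fun i => π (σ⁻¹ i)) (colPerm σ T) := by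
  refine ⟨fun i hi j => hT.1 i hi _, fun i hi => ?_, fun j => hT.2.2 _⟩
  obtain ⟨j, hj, huniq⟩ := hT.2.1 i hi
  exact ⟨σ j, by simpa [Jellyfish.colPerm] using hj,
    fun k hk => by rw [← huniq _ hk]; simp⟩

theorem isJelly_colPerm_iff {n d r : ℕ} {π : Fin d → Finset (Fin n)}
    {T : Tab (n - (d-1)*r) n d} (σ : Equiv.Perm (Fin d)) :
    IsJelly n d r (fun i => π (σ⁻¹ i)) (colPerm σ T) ↔ IsJelly n d r π T := by
  refine ⟨fun h => ?_, fun h => h.colPerm σ⟩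
  have h' := h.colPerm σ⁻¹
  have hT : colPerm σ⁻¹ (colPerm σ T) = T := (colPermEquiv _ _ σ).left_inv T
  simpa [hT] using h'

theorem JProd_colPerm {ν n d : ℕ} (π : Fin d → Finset (Fin n)) (T : Tab ν n d)
    (σ : Equiv.Perm (Fin d)) :
    JProd (fun i => π (σ⁻¹ i)) (colPerm σ T) = JProd π T :=
  Equiv.prod_comp σ⁻¹ fun j => minor ν n (rowsUsed T j) (π j)

/-- if `π' = σ(π)` is obtained from `π` by permuting its blocks, then
`[π]_r = sgn(σ)^r · [π']_r`. -/
theorem statement2 (n d r : ℕ) (hn : 0 < n) (hd : 0 < d) (hr : 0 < r)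
    (π : Fin d → Finset (Fin n)) (hπ : IsOSP n d r π) (σ : Equiv.Perm (Fin d)) :
    jellyInv n d r π =
      (((Equiv.Perm.sign σ : ℤ) : ℂ)) ^ r • jellyInv n d r (fun i => π (σ⁻¹ i)) := by
  have hsq : ((Equiv.Perm.sign σ : ℤ) : ℂ) ^ r * ((Equiv.Perm.sign σ : ℤ) : ℂ) ^ r = 1 := by
    rw [← mul_pow, ← Int.cast_mul, Int.units_coe_mul_self, Int.cast_one, one_pow]
  rw [jellyInv, jellyInv, ← Equiv.sum_comp (colPermEquiv _ _ σ) fun T =>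
    if IsJelly n d r (fun i => π (σ⁻¹ i)) T then
      (tabSign T : ℂ) • JProd (fun i => π (σ⁻¹ i)) T else 0, Finset.smul_sum]
  refine Finset.sum_congr rfl fun T _ => ?_
  change _ = ((Equiv.Perm.sign σ : ℤ) : ℂ) ^ r •
    if IsJelly n d r (fun i => π (σ⁻¹ i)) (colPerm σ T) then
    (tabSign (colPerm σ T) : ℂ) • JProd (fun i => π (σ⁻¹ i)) (colPerm σ T) else 0
  simp only [isJelly_colPerm_iff, JProd_colPerm]
  split_ifs with hT
  · rw [tabSign_colPerm hπ hd hT, smul_smul]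
    push_cast
    rw [← mul_assoc, hsq, one_mul]
  · rw [smul_zero]

end Jellyfish
end

section
/- Let r ≥ 1 and partition {1,…,n} into d+1 nonempty sets π_1, π_2, …, π_{d−2}, A, B, C with |C| = r. Then, as polynomials, [(π_1 | … | π_{d−2} | A∪B | C)]_r = Σ_{S ⊆ C} (−1)^{|S|} [(π_1 | … | π_{d−2} | A∪S | B∪(C∖S))]_r, where the sum is over all subsets S of C. -/
open scoped Classical

namespace Jellyfish

/-- The sign of the comparison `a < b`, with values in `{1, 0, -1}`. -/
def cmpSign {L : Type*} [LinearOrder L] (a b : L) : ℤ :=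
  if a < b then 1 else if b < a then -1 else 0

/-- `(-1)` to the number of inversions of the sequence `κ`, or `0` if `κ` has a repetition. -/
def seqSign {n : ℕ} {L : Type*} [LinearOrder L] (κ : Fin n → L) : ℤ :=
  ∏ j, ∏ i ∈ Finset.Iio j, cmpSign (κ i) (κ j)

/-- The position of `v` in the row reading order, when `v` sits in row `ρ v` and column `c v`. -/
def readingKey {ν n d : ℕ} (c : Fin n → Fin d) (ρ : Fin n → Fin ν) (v : Fin n) :
    Fin ν ×ₗ Fin d := toLex (ρ v, c v)

/-- Placing each `v` in row `ρ v` and column `c v` gives a (not necessarily column-sorted)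
filling of an `r`-jellyfish shape. -/
structure IsFilling {ν n d : ℕ} (r : ℕ) (c : Fin n → Fin d) (ρ : Fin n → Fin ν) : Prop where
  inj : ∀ u v, ρ u = ρ v → c u = c v → u = v
  top : ∀ i : Fin ν, (i : ℕ) < r → ∀ j, ∃ v, ρ v = i ∧ c v = j
  bot : ∀ i : Fin ν, r ≤ (i : ℕ) → ∃! v, ρ v = i

/-- The coefficient of `∏ v, x_{ρ v, v}` in the jellyfish invariant of the partition with
block function `c`. -/
noncomputable def fillCoeff {ν n d : ℕ} (r : ℕ) (c : Fin n → Fin d) (ρ : Fin n → Fin ν) : ℤ :=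
  if IsFilling r c ρ then seqSign (readingKey c ρ) else 0

lemma cmpSign_antisymm {L : Type*} [LinearOrder L] (a b : L) : cmpSign a b = -cmpSign b a := by
  unfold cmpSign
  rcases lt_trichotomy a b with h | h | h
  · simp [h, h.not_gt]
  · simp [h]
  · simp [h, h.not_gt]

lemma seqSign_comp_perm {n : ℕ} {L : Type*} [LinearOrder L] (κ : Fin n → L)
    (σ : Equiv.Perm (Fin n)) : seqSign (κ ∘ σ) = Equiv.Perm.sign σ * seqSign κ := by
  have := σ.prod_Iio_comp_eq_sign_mul_prod (R := ℤ) (f := fun i j => cmpSign (κ i) (κ j))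
    (fun i j => cmpSign_antisymm _ _)
  simpa [seqSign] using this

section fillCoeff

variable {ν n d r : ℕ} {c c' : Fin n → Fin d} {ρ : Fin n → Fin ν}

lemma fillCoeff_eq_zero {u v : Fin n} (huv : u ≠ v) (hρ : ρ u = ρ v) (hc : c u = c v) :
    fillCoeff r c ρ = 0 :=
  if_neg fun h => huv (h.inj u v hρ hc)

lemma IsFilling.congr (h : IsFilling r c ρ) (hcc : ∀ v, (ρ v : ℕ) < r → c v = c' v) :
    IsFilling r c' ρ where
  inj u v huv hc := by
    by_cases hu : (ρ u : ℕ) < r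
    · exact h.inj u v huv (by rw [hcc u hu, hcc v (huv ▸ hu), hc])
    · exact (h.bot (ρ u) (not_lt.1 hu)).unique rfl huv.symm
  top i hi j := by
    obtain ⟨v, rfl, hv⟩ := h.top i hi j
    exact ⟨v, rfl, (hcc v hi).symm.trans hv⟩
  bot := h.bot

lemma fillCoeff_congr (hcc : ∀ v, (ρ v : ℕ) < r → c v = c' v) :
    fillCoeff r c ρ = fillCoeff r c' ρ := by
  by_cases h : IsFilling r c ρ
  · have h' := h.congr hcc
    rw [fillCoeff, fillCoeff, if_pos h, if_pos h']
    refine Finset.prod_congr rfl fun j _ => Finset.prod_congr rfl fun i hi => ?_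
    have hij : i ≠ j := (Finset.mem_Iio.1 hi).ne
    by_cases hρ : ρ i = ρ j
    · have hr : (ρ i : ℕ) < r := by
        by_contra hr
        exact hij ((h.bot (ρ i) (not_lt.1 hr)).unique rfl hρ.symm)
      simp only [readingKey, hcc i hr, hcc j (hρ ▸ hr)]
    · simp [cmpSign, readingKey, Prod.Lex.toLex_lt_toLex, hρ, Ne.symm hρ]
  · have h' : ¬ IsFilling r c' ρ := fun h' => h (h'.congr fun v hv => (hcc v hv).symm)
    rw [fillCoeff, fillCoeff, if_neg h, if_neg h']

lemma IsFilling.comp_perm (σ : Equiv.Perm (Fin n)) (h : IsFilling r c ρ) :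
    IsFilling r (c ∘ σ) (ρ ∘ σ) where
  inj u v huv hc := σ.injective (h.inj _ _ huv hc)
  top i hi j := by
    obtain ⟨v, h1, h2⟩ := h.top i hi j
    exact ⟨σ.symm v, by simpa using h1, by simpa using h2⟩
  bot i hi := by
    obtain ⟨v, h1, h2⟩ := h.bot i hi
    exact ⟨σ.symm v, by simpa using h1, fun w hw => by rw [← h2 _ hw]; simp⟩

lemma isFilling_comp_perm_iff (σ : Equiv.Perm (Fin n)) :
    IsFilling r (c ∘ σ) (ρ ∘ σ) ↔ IsFilling r c ρ := by
  refine ⟨fun h => ?_, fun h => h.comp_perm σ⟩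
  have := h.comp_perm σ.symm
  simpa [Function.comp_assoc] using this

lemma fillCoeff_comp_swap {x y : Fin n} (hxy : x ≠ y) (hρ : ρ x = ρ y) :
    fillCoeff r (c ∘ Equiv.swap x y) ρ = -fillCoeff r c ρ := by
  have hs : ρ ∘ Equiv.swap x y = ρ := by
    ext v
    by_cases h1 : v = x
    · simp [h1, hρ]
    · by_cases h2 : v = y
      · simp [h2, hρ]
      · simp [Equiv.swap_apply_of_ne_of_ne h1 h2]
  have hiff := isFilling_comp_perm_iff (r := r) (c := c) (ρ := ρ) (Equiv.swap x y)
  rw [hs] at hiff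
  have hsign : seqSign (readingKey (c ∘ Equiv.swap x y) ρ) = -seqSign (readingKey c ρ) := by
    have := seqSign_comp_perm (readingKey c ρ) (Equiv.swap x y)
    rw [Equiv.Perm.sign_swap hxy] at this
    have hk : readingKey (c ∘ Equiv.swap x y) ρ = readingKey c ρ ∘ Equiv.swap x y := by
      conv_lhs => rw [← hs]
      rfl
    rw [hk, this]; simp
  by_cases h : IsFilling r c ρ
  · rw [fillCoeff, fillCoeff, if_pos h, if_pos (hiff.2 h), hsign]
  · rw [fillCoeff, fillCoeff, if_neg h, if_neg (mt hiff.1 h), neg_zero]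

/-- Recolour the elements of `S` with `k₁` and the other elements of `B` with `k₂`. -/
noncomputable def recolor (k₁ k₂ : Fin d) (c : Fin n → Fin d) (B S : Finset (Fin n)) (v : Fin n) :
    Fin d :=
  if v ∈ S then k₁ else if v ∈ B then k₂ else c v

/-- Exchanging the colours of the pairs `x, p x`, `x ∈ S`, each lying in a single row, multiplies
the coefficient by `(-1) ^ |S|`. -/
lemma fillCoeff_recolor_image {k₁ k₂ : Fin d} (p : Fin n → Fin n) (S : Finset (Fin n))
    (hp : Set.InjOn p S) (hρp : ∀ x ∈ S, ρ (p x) = ρ x) (hS : ∀ x ∈ S, c x = k₂)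
    (hpS : ∀ x ∈ S, c (p x) = k₁) (hk : k₁ ≠ k₂) :
    fillCoeff r (recolor k₁ k₂ c (S.image p) S) ρ = (-1) ^ S.card * fillCoeff r c ρ := by
  induction S using Finset.induction_on with
  | empty =>
    have : recolor k₁ k₂ c ∅ ∅ = c := by ext v; simp [recolor]
    simp [this]
  | insert x S hx ih =>
    have hne : x ≠ p x := fun h => hk <| by
      rw [← hpS x (by simp), ← hS x (by simp), ← h]
    have ih' := ih (hp.mono (by simp)) (fun y hy => hρp y (by simp [hy]))
      (fun y hy => hS y (by simp [hy])) (fun y hy => hpS y (by simp [hy]))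
    have hstep : recolor k₁ k₂ c ((insert x S).image p) (insert x S) =
        recolor k₁ k₂ c (S.image p) S ∘ Equiv.swap x (p x) := by
      have hpx : p x ∉ S := fun h => hk <| by rw [← hpS x (by simp), hS (p x) (by simp [h])]
      have hpx' : p x ∉ S.image p := by
        simp only [Finset.mem_image, not_exists, not_and]
        intro y hy hyx
        exact hx (hp (by simp [hy]) (by simp) hyx ▸ hy)
      have hxp : x ∉ S.image p := by
        simp only [Finset.mem_image, not_exists, not_and]
        intro y hy hyx
        exact hk (by rw [← hpS y (by simp [hy]), hyx, hS x (by simp)])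
      ext v
      by_cases h1 : v = x
      · subst h1
        simp [recolor, hpx, hpx', hpS v]
      · by_cases h2 : v = p x
        · subst h2
          simp [recolor, hpx, hx, hxp, hne.symm, hS x]
        · simp [recolor, Equiv.swap_apply_of_ne_of_ne h1 h2, h1, h2, eq_comm]
    rw [hstep, fillCoeff_comp_swap hne (hρp x (by simp)).symm, ih', Finset.card_insert_of_notMem hx]
    ring

lemma eq_zero_of_eq_neg_reindex {ι : Type*} (s : Finset ι) (f : ι → ℤ) (g : ι → ι)
    (hg : ∀ a ∈ s, g a ∈ s) (hgg : ∀ a ∈ s, g (g a) = a) (hf : ∀ a ∈ s, f (g a) = -f a) :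
    ∑ a ∈ s, f a = 0 := by
  refine Finset.sum_involution (fun a _ => g a) (fun a ha => by simp [hf a ha])
    (fun a ha h0 h => h0 ?_) hg hgg
  have := hf a ha
  rw [h] at this
  omega

theorem fillCoeff_recurrence {k₁ k₂ : Fin d} (hk : k₁ ≠ k₂) {B C : Finset (Fin n)}
    (hC : ∀ v, c v = k₂ ↔ v ∈ C) (hB : ∀ v ∈ B, c v = k₁) (hcard : C.card = r) :
    fillCoeff r c ρ =
      ∑ S ∈ C.powerset, (-1) ^ S.card * fillCoeff r (recolor k₁ k₂ c B S) ρ := by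
  have hBC : ∀ v ∈ B, v ∉ C := fun v hv hvC => hk (by rw [← hB v hv, (hC v).2 hvC])
  by_cases hlow : ∃ x ∈ C, r ≤ (ρ x : ℕ)
  · obtain ⟨x, hxC, hx⟩ := hlow
    have hl : fillCoeff r c ρ = 0 := by
      refine if_neg fun h => ?_
      have hsub : Finset.range r ⊆ (C.erase x).image (fun v => (ρ v : ℕ)) := by
        intro i hi
        rw [Finset.mem_range] at hi
        obtain ⟨v, hv, hvk⟩ := h.top ⟨i, hi.trans (hx.trans_lt (ρ x).2)⟩ hi k₂
        have hvi : (ρ v : ℕ) = i := congrArg Fin.val hv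
        refine Finset.mem_image.2 ⟨v, Finset.mem_erase.2 ⟨?_, (hC v).1 hvk⟩, hvi⟩
        rintro rfl
        omega
      have hle := (Finset.card_le_card hsub).trans Finset.card_image_le
      rw [Finset.card_range, Finset.card_erase_of_mem hxC] at hle
      have := Finset.card_pos.2 ⟨x, hxC⟩
      omega
    rw [hl, eq_comm]
    refine eq_zero_of_eq_neg_reindex _ _ (fun S => symmDiff S {x}) ?_ ?_ ?_
    · intro S hS
      rw [Finset.mem_powerset] at hS ⊢
      intro v hv
      rcases Finset.mem_symmDiff.1 hv with h | h
      · exact hS h.1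
      · exact (Finset.mem_singleton.1 h.1) ▸ hxC
    · intro S _; simp
    · intro S _
      have : fillCoeff r (recolor k₁ k₂ c B (symmDiff S {x})) ρ =
          fillCoeff r (recolor k₁ k₂ c B S) ρ := by
        refine fillCoeff_congr fun v hv => ?_
        have : v ≠ x := by rintro rfl; omega
        simp [recolor, Finset.mem_symmDiff, this]
      rw [this]
      by_cases hxS : x ∈ S
      · have h1 : symmDiff S {x} = S.erase x := by
          ext v; by_cases hv : v = x <;> simp [Finset.mem_symmDiff, hv, hxS]
        have h2 : S.card = (S.erase x).card + 1 := by
          rw [Finset.card_erase_add_one hxS]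
        rw [h1, h2]; ring
      · have h1 : symmDiff S {x} = insert x S := by
          ext v; by_cases hv : v = x <;> simp [Finset.mem_symmDiff, hv, hxS]
        rw [h1, Finset.card_insert_of_notMem hxS]; ring
  push Not at hlow
  by_cases hinj : Set.InjOn ρ C
  swap
  · obtain ⟨x, hx, y, hy, hρ, hxy⟩ : ∃ x ∈ C, ∃ y ∈ C, ρ x = ρ y ∧ x ≠ y := by
      simpa [Set.InjOn] using hinj
    rw [fillCoeff_eq_zero hxy hρ (by rw [(hC x).2 hx, (hC y).2 hy]), eq_comm]
    have hsC : ∀ v, Equiv.swap x y v ∈ C ↔ v ∈ C := by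
      intro v
      by_cases h1 : v = x
      · simp [h1, hx, hy]
      · by_cases h2 : v = y
        · simp [h2, hx, hy]
        · simp [Equiv.swap_apply_of_ne_of_ne h1 h2]
    have hmem : ∀ (S : Finset (Fin n)) v,
        v ∈ S.map (Equiv.swap x y).toEmbedding ↔ Equiv.swap x y v ∈ S := by
      intro S v; simp [Finset.mem_map_equiv]
    refine eq_zero_of_eq_neg_reindex _ _ (fun S => S.map (Equiv.swap x y).toEmbedding) ?_ ?_ ?_
    · intro S hS
      rw [Finset.mem_powerset] at hS ⊢
      intro v hv
      exact (hsC v).1 (hS ((hmem S v).1 hv))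
    · intro S _
      ext v; simp only [hmem, Equiv.swap_apply_self]
    · intro S hS
      have : recolor k₁ k₂ c B (S.map (Equiv.swap x y).toEmbedding) =
          recolor k₁ k₂ c B S ∘ Equiv.swap x y := by
        ext v
        simp only [recolor, hmem, Function.comp_apply]
        by_cases h1 : v = x
        · simp [h1, mt (hBC _) (not_not.2 hx), mt (hBC _) (not_not.2 hy), (hC x).2 hx, (hC y).2 hy]
        · by_cases h2 : v = y
          · simp [h2, mt (hBC _) (not_not.2 hx), mt (hBC _) (not_not.2 hy), (hC x).2 hx,
              (hC y).2 hy]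
          · simp [Equiv.swap_apply_of_ne_of_ne h1 h2]
      rw [this, fillCoeff_comp_swap hxy hρ, Finset.card_map]; ring
  -- every top row contains exactly one element of `C`
  have hrow : ∀ i : Fin ν, (i : ℕ) < r → ∃ x ∈ C, ρ x = i := by
    have himg : C.image (fun v => (ρ v : ℕ)) = Finset.range r := by
      refine Finset.eq_of_subset_of_card_le (fun i hi => ?_) ?_
      · obtain ⟨v, hv, rfl⟩ := Finset.mem_image.1 hi
        exact Finset.mem_range.2 (hlow v hv)
      · rw [Finset.card_range, Finset.card_image_of_injOn, hcard]
        exact fun u hu v hv huv => hinj hu hv (Fin.ext huv)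
    intro i hi
    obtain ⟨x, hx, hxi⟩ := Finset.mem_image.1 (himg ▸ Finset.mem_range.2 hi)
    exact ⟨x, hx, Fin.ext hxi⟩
  by_cases hBinj : ∃ b ∈ B, ∃ b' ∈ B, b ≠ b' ∧ ρ b = ρ b'
  · obtain ⟨b, hb, b', hb', hne, hρ⟩ := hBinj
    rw [fillCoeff_eq_zero hne hρ (by rw [hB b hb, hB b' hb']), eq_comm]
    refine Finset.sum_eq_zero fun S hS => ?_
    rw [Finset.mem_powerset] at hS
    rw [fillCoeff_eq_zero hne hρ, mul_zero]
    rw [recolor, recolor, if_neg (fun h => hBC b hb (hS h)), if_neg (fun h => hBC b' hb' (hS h)),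
      if_pos hb, if_pos hb']
  push Not at hBinj
  set S₀ := C.filter (fun x => ∃ b ∈ B, ρ b = ρ x) with hS₀
  have hS₀C : S₀ ⊆ C := Finset.filter_subset _ _
  rw [Finset.sum_eq_single_of_mem S₀ (Finset.mem_powerset.2 hS₀C)]
  · choose! p hpB hpρ using fun x (hx : x ∈ S₀) => (Finset.mem_filter.1 hx).2
    have himg := fillCoeff_recolor_image (r := r) (c := c) (ρ := ρ) (k₁ := k₁) (k₂ := k₂) p S₀
      (fun x hx y hy hxy => hinj (hS₀C hx) (hS₀C hy) (by rw [← hpρ x hx, ← hpρ y hy, hxy]))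
      hpρ (fun x hx => (hC x).2 (hS₀C hx)) (fun x hx => hB _ (hpB x hx)) hk
    have hcongr : fillCoeff r (recolor k₁ k₂ c B S₀) ρ =
        fillCoeff r (recolor k₁ k₂ c (S₀.image p) S₀) ρ := by
      refine fillCoeff_congr fun v hv => ?_
      have : v ∈ B ↔ v ∈ S₀.image p := by
        constructor
        · intro hvB
          obtain ⟨x, hx, hxv⟩ := hrow _ hv
          have hxS : x ∈ S₀ := Finset.mem_filter.2 ⟨hx, v, hvB, hxv.symm⟩
          refine Finset.mem_image.2 ⟨x, hxS, ?_⟩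
          by_contra hne
          exact hBinj _ (hpB x hxS) v hvB hne (by rw [hpρ x hxS, hxv])
        · intro h
          obtain ⟨x, hx, rfl⟩ := Finset.mem_image.1 h
          exact hpB x hx
      simp only [recolor, this]
    rw [hcongr, himg, ← mul_assoc, ← mul_pow]; simp
  · intro S hS hne
    rw [Finset.mem_powerset] at hS
    rw [fillCoeff, if_neg, mul_zero]
    intro h
    apply hne
    ext x
    by_cases hxC : x ∈ C
    swap
    · exact ⟨fun h => absurd (hS h) hxC, fun h => absurd (hS₀C h) hxC⟩
    constructor
    · intro hxS
      refine Finset.mem_filter.2 ⟨hxC, ?_⟩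
      obtain ⟨b, hb, hbk⟩ := h.top (ρ x) (hlow x hxC) k₂
      have hbS : b ∉ S := fun hbS => hk (by rw [← hbk]; simp [recolor, hbS])
      refine ⟨b, ?_, hb⟩
      by_contra hbB
      have hbC : b ∈ C := (hC b).1 (by rw [← hbk]; simp [recolor, hbS, hbB])
      exact hbS (hinj hbC hxC hb ▸ hxS)
    · intro hx
      obtain ⟨b, hbB, hb⟩ := (Finset.mem_filter.1 hx).2
      by_contra hxS
      have hbx : b = x := by
        refine h.inj b x hb ?_
        have hbS : b ∉ S := fun hbS => hBC b hbB (hS hbS)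
        simp [recolor, hxS, hbS, hbB, (hC x).2 hxC]
      exact hBC b hbB (hbx ▸ hxC)

end fillCoeff

section expansion

variable {ν n d r : ℕ} {c : Fin n → Fin d} {t t' ρ : Fin n → Fin ν}

/-- `t` is increasing on every block of `c`. -/
def BlockMono (c : Fin n → Fin d) (t : Fin n → Fin ν) : Prop :=
  ∀ u v, c u = c v → u < v → t u < t v

/-- The tableau in which `v` sits in row `t v` and column `c v`. -/
noncomputable def tabOf (c : Fin n → Fin d) (t : Fin n → Fin ν) : Tab ν n d := fun i j =>
  if h : ∃ v, t v = i ∧ c v = j then some h.choose else none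

lemma isSome_tabOf (i : Fin ν) (j : Fin d) :
    (tabOf c t i j).isSome ↔ ∃ v, t v = i ∧ c v = j := by
  by_cases h : ∃ v, t v = i ∧ c v = j
  · rw [tabOf, dif_pos h]
    simpa using h
  · rw [tabOf, dif_neg h]
    simpa using h

lemma IsFilling.tabOf_eq_some (h : IsFilling r c t) {i : Fin ν} {j : Fin d} {v : Fin n} :
    tabOf c t i j = some v ↔ t v = i ∧ c v = j := by
  constructor
  · intro hv
    by_cases hex : ∃ v, t v = i ∧ c v = j
    · rw [tabOf, dif_pos hex, Option.some_inj] at hv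
      exact hv ▸ hex.choose_spec
    · simp [tabOf, dif_neg hex] at hv
  · intro hv
    have hex : ∃ v, t v = i ∧ c v = j := ⟨v, hv⟩
    rw [tabOf, dif_pos hex, Option.some_inj]
    exact h.inj _ _ (hex.choose_spec.1.trans hv.1.symm) (hex.choose_spec.2.trans hv.2.symm)

lemma colList_eq_sort_iff (T : Tab ν n d) (j : Fin d) (s : Finset (Fin n)) :
    colList T j = s.sort (· ≤ ·) ↔
      (∀ i i' v v', i < i' → T i j = some v → T i' j = some v' → v < v') ∧
        ∀ v, v ∈ s ↔ ∃ i, T i j = some v := by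
  have hpw : (colList T j).Pairwise (· < ·) ↔
      ∀ i i' v v', i < i' → T i j = some v → T i' j = some v' → v < v' := by
    rw [colList, List.pairwise_filterMap]
    constructor
    · intro h i i' v v' hii hv hv'
      have := (List.pairwise_iff_getElem.1 h) i i' (by simp) (by simp) hii
      exact this v (by simpa using hv) v' (by simpa using hv')
    · intro h
      exact (List.pairwise_lt_finRange ν).imp fun hii b hb b' hb' => h _ _ _ _ hii hb hb'
  have hmem : ∀ v, v ∈ colList T j ↔ ∃ i, T i j = some v := by
    intro v; simp [colList]
  constructor
  · intro h
    refine ⟨hpw.1 (h ▸ (Finset.sortedLT_sort s).pairwise), fun v => ?_⟩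
    rw [← hmem, h, Finset.mem_sort]
  · rintro ⟨h1, h2⟩
    have hlt := hpw.2 h1
    have hs : (colList T j).toFinset = s := by
      ext v; rw [List.mem_toFinset, hmem, h2]
    rw [← hs, eq_comm, List.toFinset_sort _ (hlt.imp fun h => h.ne)]
    exact hlt.imp fun h => h.le

lemma isJelly_iff {π : Fin d → Finset (Fin n)} (hπ : ∀ v j, v ∈ π j ↔ c v = j)
    (T : Tab (n - (d - 1) * r) n d) :
    IsJelly n d r π T ↔ ∃ t, (IsFilling r c t ∧ BlockMono c t) ∧ tabOf c t = T := by
  simp only [IsJelly, colList_eq_sort_iff, hπ]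
  constructor
  · rintro ⟨htop, hbot, hcol⟩
    choose t ht using fun v => ((hcol (c v)).2 v).1 rfl
    have hT : ∀ i j v, T i j = some v ↔ t v = i ∧ c v = j := by
      intro i j v
      constructor
      · intro h
        have hc : c v = j := ((hcol j).2 v).2 ⟨i, h⟩
        subst hc
        refine ⟨?_, rfl⟩
        by_contra hne
        rcases lt_or_gt_of_ne hne with hlt | hlt
        · exact lt_irrefl _ ((hcol _).1 _ _ _ _ hlt (ht v) h)
        · exact lt_irrefl _ ((hcol _).1 _ _ _ _ hlt h (ht v))
      · rintro ⟨rfl, rfl⟩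
        exact ht v
    have hsome : ∀ i j, (T i j).isSome ↔ ∃ v, t v = i ∧ c v = j := by
      intro i j; simp only [Option.isSome_iff_exists, hT]
    have hfill : IsFilling r c t := by
      refine ⟨fun u v hu hc => ?_, fun i hi j => (hsome i j).1 (htop i hi j), fun i hi => ?_⟩
      · have h1 := ht u
        rw [hu, hc, ht v] at h1
        exact (Option.some_inj.1 h1).symm
      · obtain ⟨j, hj, hj'⟩ := hbot i hi
        obtain ⟨v, hv, hvj⟩ := (hsome i j).1 hj
        refine ⟨v, hv, fun w hw => ?_⟩
        have hwj := hj' (c w) ((hsome i _).2 ⟨w, hw, rfl⟩)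
        have h1 := (hT i j w).2 ⟨hw, hwj⟩
        rw [(hT i j v).2 ⟨hv, hvj⟩] at h1
        exact (Option.some_inj.1 h1).symm
    refine ⟨t, ⟨hfill, fun u v huv hlt => ?_⟩, ?_⟩
    · rcases lt_trichotomy (t u) (t v) with h | h | h
      · exact h
      · exact absurd (hfill.inj u v h huv) hlt.ne
      · exact absurd ((hcol (c u)).1 _ _ _ _ h (huv ▸ ht v) (ht u)) hlt.not_gt
    · funext i j
      ext v
      rw [hfill.tabOf_eq_some, hT]
  · rintro ⟨t, ⟨hf, hm⟩, rfl⟩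
    simp only [isSome_tabOf, hf.tabOf_eq_some]
    refine ⟨fun i hi j => hf.top i hi j, fun i hi => ?_, fun j => ⟨?_, fun v => ?_⟩⟩
    · obtain ⟨v, hv, huniq⟩ := hf.bot i hi
      refine ⟨c v, ⟨v, hv, rfl⟩, ?_⟩
      rintro j ⟨w, hw, rfl⟩
      rw [huniq w hw]
    · rintro i i' v v' hii ⟨rfl, rfl⟩ ⟨rfl, hc⟩
      by_contra hle
      rcases (not_lt.1 hle).eq_or_lt with h | h
      · exact hii.ne (h ▸ rfl)
      · exact hii.not_gt (hm _ _ hc h)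
    · simp

lemma neg_one_pow_invList {L : Type*} [LinearOrder L] (κ : Fin n → L)
    (l : List (Fin d × Fin n)) (hl : l.Pairwise fun a b => κ a.2 < κ b.2) :
    (-1 : ℤ) ^ invList l = ∏ j ∈ (l.map Prod.snd).toFinset, ∏ i ∈ (l.map Prod.snd).toFinset,
      if i < j ∧ κ j < κ i then -1 else 1 := by
  induction l with
  | nil => simp [invList]
  | cons a l ih =>
    obtain ⟨ha, hl⟩ := List.pairwise_cons.1 hl
    have hnd : (l.map Prod.snd).Nodup := by
      rw [List.Nodup, List.pairwise_map]
      exact hl.imp fun h e => h.ne (congrArg κ e)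
    have hnot : a.2 ∉ (l.map Prod.snd).toFinset := by
      simp only [List.mem_toFinset, List.mem_map, not_exists, not_and]
      intro b hb e
      exact (ha b hb).ne (congrArg κ e.symm)
    have hmem : ∀ j ∈ (l.map Prod.snd).toFinset, κ a.2 < κ j := by
      intro j hj
      obtain ⟨b, hb, rfl⟩ := List.mem_map.1 (List.mem_toFinset.1 hj)
      exact ha b hb
    rw [invList, pow_add, ih hl, List.map_cons, List.toFinset_cons, Finset.prod_insert hnot,
      Finset.prod_insert hnot]
    simp only [Finset.prod_insert hnot, Finset.prod_mul_distrib]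
    have h1 : ∏ i ∈ (l.map Prod.snd).toFinset, (if i < a.2 ∧ κ a.2 < κ i then (-1 : ℤ) else 1) =
        (-1) ^ l.countP (fun b => decide (b.2 < a.2)) := by
      have hc : l.countP (fun b => decide (b.2 < a.2)) =
          ((l.map Prod.snd).toFinset.filter (· < a.2)).card := by
        have hf : (l.map Prod.snd).toFinset.filter (· < a.2) =
            ((l.map Prod.snd).filter (fun x => decide (x < a.2))).toFinset := by
          ext x; simp
        rw [hf, List.toFinset_card_of_nodup (hnd.filter _),
          ← List.countP_eq_length_filter, List.countP_map]
        rfl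
      rw [hc, ← Finset.prod_const, Finset.prod_filter]
      exact Finset.prod_congr rfl fun i hi => by simp [hmem i hi]
    have h2 : ∏ j ∈ (l.map Prod.snd).toFinset, (if a.2 < j ∧ κ j < κ a.2 then (-1 : ℤ) else 1) =
        1 := Finset.prod_eq_one fun j hj => if_neg fun h => h.2.not_gt (hmem j hj)
    rw [h1, h2]
    simp

lemma mem_cells (T : Tab ν n d) (j : Fin d) (v : Fin n) :
    (j, v) ∈ cells T ↔ ∃ i, T i j = some v := by
  simp [cells]

lemma IsFilling.injective_readingKey (h : IsFilling r c t) :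
    Function.Injective (readingKey c t) := by
  intro u v huv
  have := Prod.ext_iff.1 (toLex.injective huv)
  exact h.inj u v this.1 this.2

lemma IsFilling.tabSign_tabOf (h : IsFilling r c t) :
    tabSign (tabOf c t) = seqSign (readingKey c t) := by
  have hpw : (cells (tabOf c t)).Pairwise
      fun a b => readingKey c t a.2 < readingKey c t b.2 := by
    rw [cells, List.pairwise_flatMap]
    constructor
    · intro i _
      rw [List.pairwise_filterMap]
      refine (List.pairwise_lt_finRange d).imp fun {j j'} hjj a ha b hb => ?_
      obtain ⟨v, hv, rfl⟩ := Option.map_eq_some_iff.1 ha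
      obtain ⟨w, hw, rfl⟩ := Option.map_eq_some_iff.1 hb
      rw [h.tabOf_eq_some] at hv hw
      simp [readingKey, Prod.Lex.toLex_lt_toLex, hv, hw, hjj]
    · refine (List.pairwise_lt_finRange ν).imp fun {i i'} hii a ha b hb => ?_
      obtain ⟨j, _, ha⟩ := List.mem_filterMap.1 ha
      obtain ⟨j', _, hb⟩ := List.mem_filterMap.1 hb
      obtain ⟨v, hv, rfl⟩ := Option.map_eq_some_iff.1 ha
      obtain ⟨w, hw, rfl⟩ := Option.map_eq_some_iff.1 hb
      rw [h.tabOf_eq_some] at hv hw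
      simp [readingKey, Prod.Lex.toLex_lt_toLex, hv, hw, hii]
  have huniv : ((cells (tabOf c t)).map Prod.snd).toFinset = Finset.univ := by
    ext v
    simp only [List.mem_toFinset, List.mem_map, Finset.mem_univ, iff_true]
    exact ⟨(c v, v), (mem_cells _ _ _).2 ⟨t v, h.tabOf_eq_some.2 ⟨rfl, rfl⟩⟩, rfl⟩
  rw [tabSign, neg_one_pow_invList _ _ hpw, huniv, seqSign]
  refine Finset.prod_congr rfl fun j _ => ?_
  rw [← Finset.prod_subset (Finset.subset_univ (Finset.Iio j))]
  · refine Finset.prod_congr rfl fun i hi => ?_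
    have hij := Finset.mem_Iio.1 hi
    rcases lt_trichotomy (readingKey c t i) (readingKey c t j) with hk | hk | hk
    · simp [cmpSign, hk, hk.not_gt]
    · exact absurd (h.injective_readingKey hk) hij.ne
    · simp [cmpSign, hk, hk.not_gt, hij]
  · intro i _ hi
    exact if_neg fun h => hi (Finset.mem_Iio.2 h.1)

lemma minor_image {J : Finset (Fin n)} {j : Fin d} (hJ : ∀ v, v ∈ J ↔ c v = j)
    (hm : BlockMono c t) {I : Finset (Fin ν)} (hI : ∀ i, i ∈ I ↔ ∃ v, t v = i ∧ c v = j) :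
    minor ν n I J = Matrix.det (Matrix.of fun a b : {v // c v = j} =>
      (MvPolynomial.X (t a, (b : Fin n)) : MvPolynomial (Fin ν × Fin n) ℂ)) := by
  have hmono : ∀ u ∈ J, ∀ v ∈ J, u < v → t u < t v := fun u hu v hv huv =>
    hm u v (((hJ u).1 hu).trans ((hJ v).1 hv).symm) huv
  have himg : J.image t = I := by
    ext i; simp only [Finset.mem_image, hI, hJ]
    exact exists_congr fun v => and_comm
  have hcard : I.card = J.card := by
    rw [← himg]
    refine Finset.card_image_of_injOn fun u hu v hv huv => ?_
    by_contra hne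
    rcases lt_or_gt_of_ne hne with h | h
    · exact (hmono u hu v hv h).ne huv
    · exact (hmono v hv u hu h).ne huv.symm
  rw [minor, dif_pos hcard]
  let e : Fin I.card ≃ {v // c v = j} :=
    (J.orderIsoOfFin hcard.symm).toEquiv.trans (Equiv.subtypeEquivRight hJ)
  have he : ∀ a, ((e a : {v // c v = j}) : Fin n) = J.orderEmbOfFin hcard.symm a := fun a => rfl
  have hrow : (fun a => t (J.orderEmbOfFin hcard.symm a)) = I.orderEmbOfFin rfl := by
    refine Finset.orderEmbOfFin_unique rfl (fun a => ?_) fun a b hab => ?_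
    · exact (hI _).2 ⟨_, rfl, (hJ _).1 (Finset.orderEmbOfFin_mem _ _ _)⟩
    · exact hmono _ (Finset.orderEmbOfFin_mem _ _ _) _ (Finset.orderEmbOfFin_mem _ _ _)
        ((J.orderEmbOfFin hcard.symm).strictMono hab)
  rw [← Matrix.det_submatrix_equiv_self e]
  congr 1
  ext1 a b
  simp only [Matrix.of_apply, Matrix.submatrix_apply, he, ← hrow]

lemma JProd_tabOf {π : Fin d → Finset (Fin n)} (hπ : ∀ v j, v ∈ π j ↔ c v = j)
    (hm : BlockMono c t) :
    JProd π (tabOf c t) = ∑ τ : Equiv.Perm (Fin n),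
      if c ∘ τ = c then ((Equiv.Perm.sign τ : ℤ) : ℂ) •
        ∏ v, (MvPolynomial.X (t (τ v), v) : MvPolynomial (Fin ν × Fin n) ℂ) else 0 := by
  set M : Matrix (Fin n) (Fin n) (MvPolynomial (Fin ν × Fin n) ℂ) :=
    Matrix.of fun u v => if c u = c v then MvPolynomial.X (t u, v) else 0 with hM
  have hdet : M.det = JProd π (tabOf c t) := by
    rw [Matrix.BlockTriangular.det_fintype (b := c)
      (fun u v huv => by simp [hM, huv.ne'])]
    refine Finset.prod_congr rfl fun j _ => ?_
    rw [minor_image (fun v => hπ v j) hm (fun i => by simp [rowsUsed, isSome_tabOf])]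
    congr 1
    ext1 a b
    simp [Matrix.toSquareBlock, Matrix.toSquareBlockProp, hM, a.2, b.2]
  rw [← hdet, Matrix.det_apply]
  refine Finset.sum_congr rfl fun τ _ => ?_
  split_ifs with h
  · have : ∏ v, M (τ v) v = ∏ v, MvPolynomial.X (t (τ v), v) :=
      Finset.prod_congr rfl fun v _ => by simp [hM, show c (τ v) = c v from congrFun h v]
    rw [this, Units.smul_def, Int.cast_smul_eq_zsmul]
  · obtain ⟨v, hv⟩ : ∃ v, c (τ v) ≠ c v := by
      by_contra hall
      push Not at hall
      exact h (funext hall)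
    rw [Finset.prod_eq_zero (Finset.mem_univ v) (by simp [hM, hv]), smul_zero]

lemma IsFilling.exists_blockMono (h : IsFilling r c ρ) :
    ∃ (t : Fin n → Fin ν) (τ : Equiv.Perm (Fin n)),
      (IsFilling r c t ∧ BlockMono c t) ∧ c ∘ τ = c ∧ t ∘ τ = ρ := by
  let κ₁ : Fin n → Fin d ×ₗ Fin n := fun v => toLex (c v, v)
  let κ₂ : Fin n → Fin d ×ₗ Fin ν := fun v => toLex (c v, ρ v)
  set σ₁ := Tuple.sort κ₁
  set σ₂ := Tuple.sort κ₂
  have h₁ := Tuple.monotone_sort κ₁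
  have h₂ := Tuple.monotone_sort κ₂
  have hc : c ∘ σ₁ = c ∘ σ₂ := by
    refine Tuple.unique_monotone (fun a b hab => ?_) fun a b hab => ?_
    · exact Prod.Lex.monotone_fst_ofLex (h₁ hab)
    · exact Prod.Lex.monotone_fst_ofLex (h₂ hab)
  set φ : Equiv.Perm (Fin n) := σ₁.symm.trans σ₂ with hφ
  have hcφ : c ∘ φ = c := by
    ext1 v
    have := congrFun hc (σ₁.symm v)
    simpa [hφ] using this.symm
  have hfill : IsFilling r c (ρ ∘ φ) := by
    have := h.comp_perm φ
    rwa [hcφ] at this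
  refine ⟨ρ ∘ φ, φ.symm, ⟨hfill, fun u v huv hlt => ?_⟩, ?_, ?_⟩
  · have hlt' : σ₁.symm u < σ₁.symm v := by
      by_contra hge
      have := h₁ (not_lt.1 hge)
      simp only [Function.comp_apply, Equiv.apply_symm_apply, κ₁, σ₁] at this
      rw [Prod.Lex.toLex_le_toLex] at this
      rcases this with h | h
      · exact h.ne huv.symm
      · exact hlt.not_ge h.2
    have hle := h₂ hlt'.le
    change toLex (c (φ u), ρ (φ u)) ≤ toLex (c (φ v), ρ (φ v)) at hle
    have hcu : c (φ u) = c u := congrFun hcφ u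
    have hcv : c (φ v) = c v := congrFun hcφ v
    rw [hcu, hcv, huv, Prod.Lex.toLex_le_toLex] at hle
    refine lt_of_le_of_ne (hle.resolve_left (lt_irrefl _)).2 fun heq => ?_
    exact hlt.ne (hfill.inj u v heq huv)
  · conv_lhs => rw [← hcφ]
    ext v; simp
  · ext v; simp

lemma BlockMono.factor_unique (hm : BlockMono c t) (hm' : BlockMono c t')
    {τ τ' : Equiv.Perm (Fin n)} (hτ : c ∘ τ = c) (hτ' : c ∘ τ' = c) (h : t ∘ τ = t' ∘ τ') :
    t = t' ∧ τ = τ' := by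
  set φ : Equiv.Perm (Fin n) := τ'.symm.trans τ with hφ
  have hcφ : ∀ v, c (φ v) = c v := fun v => by
    have h1 := congrFun hτ (τ'.symm v)
    have h2 := congrFun hτ' (τ'.symm v)
    simp only [Function.comp_apply, Equiv.apply_symm_apply] at h1 h2
    simp [hφ, h1, ← h2]
  have htφ : ∀ v, t' v = t (φ v) := fun v => by
    have := congrFun h (τ'.symm v)
    simpa [hφ] using this.symm
  let κ : Fin n → Fin d ×ₗ Fin n := fun v => toLex (c v, v)
  have hκφ : ∀ u v, κ u ≤ κ v → κ (φ u) ≤ κ (φ v) := by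
    intro u v huv
    rw [Prod.Lex.toLex_le_toLex] at huv ⊢
    simp only [hcφ]
    refine huv.imp_right fun ⟨hc, hle⟩ => ⟨hc, ?_⟩
    rcases hle.eq_or_lt with rfl | hlt
    · exact le_rfl
    · by_contra hgt
      have h1 := hm (φ v) (φ u) (by rw [hcφ, hcφ]; exact hc.symm) (not_le.1 hgt)
      rw [← htφ, ← htφ] at h1
      exact h1.not_gt (hm' u v hc hlt)
  have hmono := Tuple.monotone_sort κ
  have heq := Tuple.unique_monotone (f := κ) (σ := Tuple.sort κ) (τ := (Tuple.sort κ).trans φ) hmono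
    (fun a b hab => hκφ _ _ (hmono hab))
  have hid : ∀ v, φ v = v := fun v => by
    have := congrFun heq ((Tuple.sort κ).symm v)
    simp only [Function.comp_apply, Equiv.trans_apply, Equiv.apply_symm_apply] at this
    exact ((Prod.ext_iff.1 (toLex.injective this)).2).symm
  refine ⟨funext fun v => by rw [htφ, hid], Equiv.ext fun v => ?_⟩
  have := hid (τ' v)
  simpa [hφ] using this

theorem jellyInv_eq_sum_fillCoeff {π : Fin d → Finset (Fin n)} (hπ : ∀ v j, v ∈ π j ↔ c v = j) :
    jellyInv n d r π = ∑ ρ : Fin n → Fin (n - (d - 1) * r),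
      (fillCoeff r c ρ : ℂ) • ∏ v, MvPolynomial.X (ρ v, v) := by
  have himg : (Finset.univ.filter fun T => IsJelly n d r π T) =
      (Finset.univ.filter fun t => IsFilling r c t ∧ BlockMono c t).image (tabOf c) := by
    ext T
    simp [isJelly_iff hπ]
  have hinj : Set.InjOn (tabOf (ν := n - (d - 1) * r) c) ((Finset.univ.filter fun t : Fin n → Fin (n - (d - 1) * r) =>
      IsFilling r c t ∧ BlockMono c t : Finset _) : Set _) := by
    intro t ht t' ht' h
    simp only [Finset.mem_coe, Finset.mem_filter, Finset.mem_univ, true_and] at ht ht'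
    ext1 v
    have := ht.1.tabOf_eq_some.2 ⟨rfl, (rfl : c v = c v)⟩
    rw [h, ht'.1.tabOf_eq_some] at this
    exact this.1.symm
  rw [jellyInv, ← Finset.sum_filter, himg, Finset.sum_image hinj]
  have hright : ∀ ρ : Fin n → Fin (n - (d - 1) * r),
      (fillCoeff r c ρ : ℂ) • ∏ v, (MvPolynomial.X (ρ v, v) : MvPolynomial _ ℂ) =
        if IsFilling r c ρ then
          (seqSign (readingKey c ρ) : ℂ) • ∏ v, MvPolynomial.X (ρ v, v) else 0 := by
    intro ρ
    by_cases h : IsFilling r c ρ <;> simp [fillCoeff, h]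
  simp only [hright]
  rw [← Finset.sum_filter]
  have hleft : ∀ t ∈ Finset.univ.filter (fun t : Fin n → Fin (n - (d - 1) * r) =>
      IsFilling r c t ∧ BlockMono c t), (tabSign (tabOf c t) : ℂ) • JProd π (tabOf c t) =
      ∑ τ ∈ Finset.univ.filter (fun τ : Equiv.Perm (Fin n) => c ∘ τ = c),
        (seqSign (readingKey c (t ∘ τ)) : ℂ) • ∏ v, MvPolynomial.X ((t ∘ τ) v, v) := by
    intro t ht
    have ht := (Finset.mem_filter.1 ht).2
    rw [JProd_tabOf hπ ht.2, ← Finset.sum_filter, Finset.smul_sum, ht.1.tabSign_tabOf]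
    refine Finset.sum_congr rfl fun τ hτ => ?_
    have hτ := (Finset.mem_filter.1 hτ).2
    have hk : readingKey c (t ∘ τ) = readingKey c t ∘ τ := by
      conv_lhs => rw [← hτ]
      rfl
    rw [hk, seqSign_comp_perm, smul_smul]
    push_cast
    rw [mul_comm (seqSign (readingKey c t) : ℂ)]
    rfl
  rw [Finset.sum_congr rfl hleft, ← Finset.sum_product']
  refine Finset.sum_bij (fun p _ => p.1 ∘ p.2) ?_ ?_ ?_ fun _ _ => rfl
  · rintro ⟨t, τ⟩ hp
    simp only [Finset.mem_product, Finset.mem_filter, Finset.mem_univ, true_and] at hp ⊢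
    have := hp.1.1.comp_perm τ
    rwa [hp.2] at this
  · rintro ⟨t, τ⟩ hp ⟨t', τ'⟩ hp' h
    simp only [Finset.mem_product, Finset.mem_filter, Finset.mem_univ, true_and] at hp hp'
    exact Prod.ext_iff.2 (hp.1.2.factor_unique hp'.1.2 hp.2 hp'.2 h)
  · intro ρ hρ
    obtain ⟨t, τ, ht, hτ, h⟩ := ((Finset.mem_filter.1 hρ).2).exists_blockMono
    exact ⟨(t, τ), by simp [ht, hτ], h⟩

end expansion

/-- the recurrence of Theorem 5.2 in the presence of `d−2` further blocks
`π_1, …, π_{d−2}` (here `e = d − 2`):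
`[(π_1 | … | π_{d−2} | A∪B | C)]_r = Σ_{S ⊆ C} (−1)^{|S|} [(π_1 | … | π_{d−2} | A∪S | B∪(C∖S))]_r`. -/
theorem statement4 (n r e : ℕ) (hr : 1 ≤ r)
    (Bl : Fin e → Finset (Fin n)) (A B C : Finset (Fin n))
    (hBl : ∀ i, (Bl i).Nonempty)
    (hA : A.Nonempty) (hB : B.Nonempty) (hC : C.Nonempty)
    (hBldisj : ∀ i j, i ≠ j → Disjoint (Bl i) (Bl j))
    (hBlA : ∀ i, Disjoint (Bl i) A) (hBlB : ∀ i, Disjoint (Bl i) B)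
    (hBlC : ∀ i, Disjoint (Bl i) C)
    (hAB : Disjoint A B) (hAC : Disjoint A C) (hBC : Disjoint B C)
    (hunion : (Finset.univ.biUnion Bl) ∪ A ∪ B ∪ C = Finset.univ)
    (hCcard : C.card = r) :
    jellyInv n (e+2) r (Fin.snoc (Fin.snoc Bl (A ∪ B)) C) =
      ∑ S ∈ C.powerset,
        ((-1 : ℂ)) ^ S.card •
          jellyInv n (e+2) r (Fin.snoc (Fin.snoc Bl (A ∪ S)) (B ∪ (C \ S))) := by
  set k₁ : Fin (e + 2) := (Fin.last e).castSucc
  set k₂ : Fin (e + 2) := Fin.last (e + 1)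
  have hk : k₁ ≠ k₂ := (Fin.castSucc_lt_last _).ne
  have hcover : ∀ v, ∃ j,
      v ∈ (Fin.snoc (Fin.snoc Bl (A ∪ B)) C : Fin (e + 2) → Finset (Fin n)) j := by
    intro v
    have hv : v ∈ (Finset.univ.biUnion Bl) ∪ A ∪ B ∪ C := hunion ▸ Finset.mem_univ v
    simp only [Finset.mem_union, Finset.mem_biUnion, Finset.mem_univ, true_and] at hv
    rcases hv with ((⟨i, hi⟩ | hv) | hv) | hv
    · exact ⟨i.castSucc.castSucc, by simpa [Fin.snoc_castSucc] using hi⟩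
    · exact ⟨k₁, by simp [k₁, Fin.snoc_castSucc, Fin.snoc_last, hv]⟩
    · exact ⟨k₁, by simp [k₁, Fin.snoc_castSucc, Fin.snoc_last, hv]⟩
    · exact ⟨k₂, by simp [k₂, Fin.snoc_last, hv]⟩
  have hdisj : ∀ j k, j ≠ k →
      Disjoint ((Fin.snoc (Fin.snoc Bl (A ∪ B)) C : Fin (e + 2) → Finset (Fin n)) j)
        ((Fin.snoc (Fin.snoc Bl (A ∪ B)) C : Fin (e + 2) → Finset (Fin n)) k) := by
    intro j k
    induction j using Fin.lastCases with
    | last =>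
      induction k using Fin.lastCases with
      | last => simp
      | cast k =>
        induction k using Fin.lastCases with
        | last => simp [Fin.snoc_castSucc, Fin.snoc_last, hAC.symm, hBC.symm]
        | cast k => simp [Fin.snoc_castSucc, Fin.snoc_last, (hBlC k).symm]
    | cast j =>
      induction j using Fin.lastCases with
      | last =>
        induction k using Fin.lastCases with
        | last => simp [Fin.snoc_castSucc, Fin.snoc_last, hAC, hBC]
        | cast k =>
          induction k using Fin.lastCases with
          | last => simp
          | cast k => simp [Fin.snoc_castSucc, Fin.snoc_last, (hBlA k).symm, (hBlB k).symm]
      | cast j =>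
        induction k using Fin.lastCases with
        | last => simp [Fin.snoc_castSucc, Fin.snoc_last, hBlC j]
        | cast k =>
          induction k using Fin.lastCases with
          | last => simp [Fin.snoc_castSucc, Fin.snoc_last, hBlA j, hBlB j]
          | cast k =>
            intro hjk
            simpa [Fin.snoc_castSucc] using hBldisj j k (by simpa using hjk)
  choose c hc using hcover
  have hπ : ∀ v j, v ∈ (Fin.snoc (Fin.snoc Bl (A ∪ B)) C : Fin (e + 2) → Finset (Fin n)) j ↔
      c v = j := by
    refine fun v j => ⟨fun hv => ?_, fun h => h ▸ hc v⟩
    by_contra hne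
    exact Finset.disjoint_left.1 (hdisj _ _ hne) (hc v) hv
  have hcC : ∀ v, c v = k₂ ↔ v ∈ C := fun v => by
    simpa [k₂, Fin.snoc_last] using (hπ v k₂).symm
  have hcAB : ∀ v, c v = k₁ ↔ v ∈ A ∨ v ∈ B := fun v => by
    simpa [k₁, Fin.snoc_castSucc, Fin.snoc_last] using (hπ v k₁).symm
  have hcBl : ∀ v i, c v = i.castSucc.castSucc ↔ v ∈ Bl i := fun v i => by
    simpa [Fin.snoc_castSucc] using (hπ v i.castSucc.castSucc).symm
  have hπS : ∀ S ∈ C.powerset, ∀ v j,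
      v ∈ (Fin.snoc (Fin.snoc Bl (A ∪ S)) (B ∪ (C \ S)) : Fin (e + 2) → Finset (Fin n)) j ↔
        recolor k₁ k₂ c B S v = j := by
    intro S hS v j
    have hSC : v ∈ S → v ∈ C := fun h => Finset.mem_powerset.1 hS h
    have hvAB : v ∈ A → v ∉ B := fun h => Finset.disjoint_left.1 hAB h
    have hvBC : v ∈ B → v ∉ C := fun h => Finset.disjoint_left.1 hBC h
    have hvAC : v ∈ A → v ∉ C := fun h => Finset.disjoint_left.1 hAC h
    rw [recolor]
    induction j using Fin.lastCases with
    | last =>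
      rw [Fin.snoc_last]
      change _ ↔ _ = k₂
      have := hcC v
      split_ifs <;> simp_all
    | cast j =>
      rw [Fin.snoc_castSucc]
      induction j using Fin.lastCases with
      | last =>
        rw [Fin.snoc_last]
        change _ ↔ _ = k₁
        have := hcAB v
        split_ifs <;> simp_all [hk.symm]
      | cast i =>
        rw [Fin.snoc_castSucc]
        have h1 : k₁ ≠ i.castSucc.castSucc := by simp [k₁, (Fin.castSucc_lt_last i).ne']
        have h2 : k₂ ≠ i.castSucc.castSucc := (Fin.castSucc_lt_last _).ne'
        have hvB : v ∈ Bl i → v ∉ B := fun h => Finset.disjoint_left.1 (hBlB i) h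
        have hvC : v ∈ Bl i → v ∉ C := fun h => Finset.disjoint_left.1 (hBlC i) h
        have := hcBl v i
        split_ifs with hvS hvB'
        · exact iff_of_false (fun h => hvC h (hSC hvS)) h1
        · exact iff_of_false (fun h => hvB h hvB') h2
        · exact this.symm
  rw [Finset.sum_congr rfl fun S hS => congrArg ((-1 : ℂ) ^ S.card • ·)
    (jellyInv_eq_sum_fillCoeff (hπS S hS)), jellyInv_eq_sum_fillCoeff hπ]
  simp only [Finset.smul_sum]
  rw [Finset.sum_comm]
  refine Finset.sum_congr rfl fun ρ _ => ?_
  rw [fillCoeff_recurrence hk hcC (fun v hv => (hcAB v).2 (Or.inr hv)) hCcard, Int.cast_sum,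
    Finset.sum_smul]
  refine Finset.sum_congr rfl fun S _ => ?_
  rw [smul_smul]
  push_cast
  rfl

end Jellyfish
end

section
/- Partition {1,…,n} into three nonempty sets A, B, C with |C| = 1. Then [(A∪B | C)]_1 + [(A∪C | B)]_1 + [(B∪C | A)]_1 = 0 as polynomials. -/
open scoped Classical

namespace Jellyfish

/-- The sign of a word, as a product over pairs of positions. -/
lemma neg_one_pow_invList_ofFn {n d : ℕ} :
    ∀ {k : ℕ} (f : Fin k → Fin d × Fin n),
      (-1 : ℤ) ^ invList (List.ofFn f) =
        ∏ i, ∏ j ∈ Finset.Ioi i, if (f i).2 < (f j).2 ∨ (f i).2 = (f j).2 then 1 else -1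
  | 0, f => by simp [invList]
  | k + 1, f => by
    rw [List.ofFn_succ, invList, pow_add, neg_one_pow_invList_ofFn, Fin.prod_univ_succ]
    congr 1
    · rw [Fin.Ioi_zero_eq_map, Finset.prod_map]
      simp only [← le_iff_lt_or_eq, Fin.coe_succEmb]
      generalize f 0 = a
      rw [show (∏ i : Fin k, if a.2 ≤ (f i.succ).2 then (1 : ℤ) else -1) =
        ((List.ofFn fun i => f i.succ).map fun b => if a.2 ≤ b.2 then (1 : ℤ) else -1).prod by
          rw [List.map_ofFn, List.prod_ofFn]; rfl]
      induction List.ofFn fun i => f i.succ with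
      | nil => simp
      | cons b l ih =>
        rw [List.countP_cons, pow_add, ih, List.map_cons, List.prod_cons, mul_comm]
        by_cases h : a.2 ≤ b.2 <;> simp [h, not_lt.mpr, not_le.mp]
    · refine Finset.prod_congr rfl fun i _ => ?_
      rw [Fin.Ioi_succ, Finset.prod_map]
      rfl

lemma neg_one_pow_invList_ofFn_perm {n d : ℕ} (c : Fin n → Fin d) (w : Equiv.Perm (Fin n)) :
    (-1 : ℤ) ^ invList (List.ofFn fun i => (c i, w i)) = Equiv.Perm.sign w := by
  rw [neg_one_pow_invList_ofFn, Equiv.Perm.sign_eq_prod_prod_Ioi]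
  push_cast
  refine Finset.prod_congr rfl fun i _ => Finset.prod_congr rfl fun j hj => ?_
  have : i ≠ j := (Finset.mem_Ioi.mp hj).ne
  by_cases h : w i < w j <;> simp [this, h]

lemma minor_eq_det {ν n k : ℕ} {R : Finset (Fin ν)} {J : Finset (Fin n)}
    (hR : R.card = k) (hJ : J.card = k) :
    minor ν n R J = Matrix.det (Matrix.of fun a b : Fin k =>
      (MvPolynomial.X (R.orderEmbOfFin hR a, J.orderEmbOfFin hJ b) :
        MvPolynomial (Fin ν × Fin n) ℂ)) := by
  subst hR
  simp [minor, hJ]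

section BlockPerm

variable {n : ℕ} {I S : Finset (Fin n)}

/-- The permutation sending `I` increasingly onto `S` and `Iᶜ` increasingly onto `Sᶜ`. -/
def blockPerm (I S : Finset (Fin n)) (h : I.card = S.card) : Equiv.Perm (Fin n) :=
  (finSumEquivOfFinset h (by rw [Finset.card_compl, Finset.card_compl, h])).symm.trans
    (finSumEquivOfFinset rfl rfl : Fin S.card ⊕ Fin Sᶜ.card ≃ Fin n)

lemma card_compl_eq (h : I.card = S.card) : Iᶜ.card = Sᶜ.card := by
  rw [Finset.card_compl, Finset.card_compl, h]

lemma blockPerm_orderEmb (h : I.card = S.card) (a : Fin S.card) :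
    blockPerm I S h (I.orderEmbOfFin h a) = S.orderEmbOfFin rfl a := by
  rw [← finSumEquivOfFinset_inl h (card_compl_eq h)]
  simp [blockPerm, -finSumEquivOfFinset_inl]
  simp

lemma blockPerm_orderEmb_compl (h : I.card = S.card) (a : Fin Sᶜ.card) :
    blockPerm I S h (Iᶜ.orderEmbOfFin (card_compl_eq h) a) = Sᶜ.orderEmbOfFin rfl a := by
  rw [← finSumEquivOfFinset_inr h (card_compl_eq h)]
  simp [blockPerm, -finSumEquivOfFinset_inr]
  simp

lemma exists_orderEmbOfFin_eq {k : ℕ} (h : I.card = k) {i : Fin n} (hi : i ∈ I) :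
    ∃ a, I.orderEmbOfFin h a = i := by
  have := Finset.range_orderEmbOfFin I h
  rw [← Finset.mem_coe, ← this] at hi
  exact hi

lemma blockPerm_mem (h : I.card = S.card) (i : Fin n) : blockPerm I S h i ∈ S ↔ i ∈ I := by
  by_cases hi : i ∈ I
  · obtain ⟨a, rfl⟩ := exists_orderEmbOfFin_eq h hi
    simp [blockPerm_orderEmb]
  · obtain ⟨a, rfl⟩ := exists_orderEmbOfFin_eq (card_compl_eq h) (Finset.mem_compl.mpr hi)
    simp only [blockPerm_orderEmb_compl, hi, iff_false]
    exact Finset.mem_compl.mp (Finset.orderEmbOfFin_mem _ _ _)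

lemma blockPerm_strictMonoOn (h : I.card = S.card) : StrictMonoOn (blockPerm I S h) I := by
  intro i hi j hj hij
  obtain ⟨a, rfl⟩ := exists_orderEmbOfFin_eq h hi
  obtain ⟨b, rfl⟩ := exists_orderEmbOfFin_eq h hj
  simpa [blockPerm_orderEmb] using hij

lemma blockPerm_strictMonoOn_compl (h : I.card = S.card) :
    StrictMonoOn (blockPerm I S h) (Iᶜ : Finset (Fin n)) := by
  intro i hi j hj hij
  obtain ⟨a, rfl⟩ := exists_orderEmbOfFin_eq (card_compl_eq h) hi
  obtain ⟨b, rfl⟩ := exists_orderEmbOfFin_eq (card_compl_eq h) hj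
  simpa [blockPerm_orderEmb_compl] using hij

/-- A matrix whose `I` rows are supported on the columns `S`, and whose other rows are supported
on the other columns, has as determinant a signed product of two minors. -/
lemma det_of_block_support {R : Type*} [CommRing R] (h : I.card = S.card)
    (N : Matrix (Fin n) (Fin n) R) (h₁ : ∀ i ∈ I, ∀ j ∉ S, N i j = 0)
    (h₂ : ∀ i ∉ I, ∀ j ∈ S, N i j = 0) :
    N.det = (Equiv.Perm.sign (blockPerm I S h) : ℤ) *
      ((Matrix.of fun a b => N (I.orderEmbOfFin h a) (S.orderEmbOfFin rfl b)).det *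
      (Matrix.of fun a b =>
        N (Iᶜ.orderEmbOfFin (card_compl_eq h) a) (Sᶜ.orderEmbOfFin rfl b)).det) := by
  set e := finSumEquivOfFinset h (card_compl_eq h)
  have key := Matrix.det_permute' (blockPerm I S h) N
  rw [← Matrix.det_submatrix_equiv_self e] at key
  have hb : (N.submatrix id (blockPerm I S h)).submatrix e e = Matrix.fromBlocks
      (Matrix.of fun a b => N (I.orderEmbOfFin h a) (S.orderEmbOfFin rfl b)) 0 0
      (Matrix.of fun a b =>
        N (Iᶜ.orderEmbOfFin (card_compl_eq h) a) (Sᶜ.orderEmbOfFin rfl b)) := by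
    ext a b
    rcases a with a | a <;> rcases b with b | b <;>
      simp only [e, Matrix.submatrix_apply, id, finSumEquivOfFinset_inl, finSumEquivOfFinset_inr,
        blockPerm_orderEmb, blockPerm_orderEmb_compl, Matrix.fromBlocks_apply₁₁,
        Matrix.fromBlocks_apply₁₂, Matrix.fromBlocks_apply₂₁, Matrix.fromBlocks_apply₂₂,
        Matrix.of_apply, Matrix.zero_apply]
    · exact h₁ _ (Finset.orderEmbOfFin_mem _ _ _) _
        (Finset.mem_compl.mp (Finset.orderEmbOfFin_mem _ _ _))
    · exact h₂ _ (Finset.mem_compl.mp (Finset.orderEmbOfFin_mem _ _ _)) _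
        (Finset.orderEmbOfFin_mem _ _ _)
  rw [hb, Matrix.det_fromBlocks_zero₂₁] at key
  rw [key, ← mul_assoc, ← Int.cast_mul, ← Units.val_mul, Int.units_mul_self]
  simp

lemma det_eq_zero_of_block_support {R : Type*} [CommRing R] (h : I.card ≠ S.card)
    (N : Matrix (Fin n) (Fin n) R) (h₁ : ∀ i ∈ I, ∀ j ∉ S, N i j = 0)
    (h₂ : ∀ i ∉ I, ∀ j ∈ S, N i j = 0) : N.det = 0 := by
  rw [Matrix.det_apply]
  refine Finset.sum_eq_zero fun σ _ => ?_
  suffices ∃ i, N (σ i) i = 0 by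
    obtain ⟨i, hi⟩ := this
    rw [Finset.prod_eq_zero (f := fun j => N (σ j) j) (Finset.mem_univ i) hi, smul_zero]
  by_contra! hne
  have hmem : ∀ i, σ i ∈ I ↔ i ∈ S := fun i =>
    ⟨fun hi => by_contra fun hj => hne i (h₁ _ hi _ hj),
      fun hj => by_contra fun hi => hne i (h₂ _ hi _ hj)⟩
  refine h (Finset.card_bij (fun i _ => σ.symm i) (fun i hi => ?_) (by simp) fun j hj => ?_)
  · simpa [hi] using (hmem (σ.symm i)).symm
  · exact ⟨σ j, (hmem j).mpr hj, by simp⟩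

end BlockPerm

section HookMatrix

variable {m : ℕ}

/-- The row of the matrix of indeterminates that becomes row `i` once row `0` is repeated. -/
def origRow (i : Fin (m + 2)) : Fin (m + 1) := Fin.cases 0 id i

@[simp] lemma origRow_zero : origRow (0 : Fin (m + 2)) = 0 := rfl

@[simp] lemma origRow_succ (k : Fin (m + 1)) : origRow k.succ = k := rfl

/-- The generic matrix with row `0` repeated, the first copy being restricted to columns `S`. -/
noncomputable def hookMatrix (S : Finset (Fin (m + 2))) :
    Matrix (Fin (m + 2)) (Fin (m + 2)) (MvPolynomial (Fin (m + 1) × Fin (m + 2)) ℂ) :=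
  Matrix.of fun i j => if i = 0 ∧ j ∉ S then 0 else MvPolynomial.X (origRow i, j)

/-- The summand of `hookMatrix S` whose rows in `I` are restricted to the columns `S` and whose
other rows are restricted to the other columns. -/
noncomputable def hookSummand (S I : Finset (Fin (m + 2))) :
    Matrix (Fin (m + 2)) (Fin (m + 2)) (MvPolynomial (Fin (m + 1) × Fin (m + 2)) ℂ) :=
  Matrix.of fun i j => if i ∈ I then (if j ∈ S then MvPolynomial.X (origRow i, j) else 0)
    else if j ∈ S ∨ i = 0 then 0 else MvPolynomial.X (origRow i, j)

lemma det_hookMatrix_eq_sum (S : Finset (Fin (m + 2))) :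
    (hookMatrix S).det = ∑ I, (hookSummand S I).det := by
  have := (Matrix.detRowAlternating (n := Fin (m + 2))
    (R := MvPolynomial (Fin (m + 1) × Fin (m + 2)) ℂ)).toMultilinearMap.map_add_univ
    (hookSummand S Finset.univ) (hookSummand S ∅)
  have h₁ : hookSummand S Finset.univ + hookSummand S ∅ = hookMatrix S := by
    ext1 i j
    by_cases hi : i = 0 <;> by_cases hj : j ∈ S <;> simp [hookSummand, hookMatrix, hi, hj]
  have h₂ : ∀ I : Finset (Fin (m + 2)),
      I.piecewise (hookSummand S Finset.univ) (hookSummand S ∅) = hookSummand S I := by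
    intro I
    funext i
    by_cases hi : i ∈ I
    · refine (Finset.piecewise_eq_of_mem _ _ _ hi).trans ?_
      ext1 j
      simp [hookSummand, hi]
    · refine (Finset.piecewise_eq_of_notMem _ _ _ hi).trans ?_
      ext1 j
      simp [hookSummand, hi]
  have h₃ : ∀ I : Finset (Fin (m + 2)),
      Matrix.detRowAlternating (I.piecewise (hookSummand S Finset.univ) (hookSummand S ∅)) =
        (hookSummand S I).det := fun I => by rw [h₂]; rfl
  rw [← h₁]
  exact this.trans (Finset.sum_congr rfl fun I _ => h₃ I)

lemma det_hookSummand_eq_zero {S I : Finset (Fin (m + 2))}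
    (h : ¬(0 ∈ I ∧ 1 ∉ I ∧ I.card = S.card)) : (hookSummand S I).det = 0 := by
  by_cases h₀ : (0 : Fin (m + 2)) ∈ I
  · by_cases h₁ : (1 : Fin (m + 2)) ∈ I
    · refine Matrix.det_zero_of_row_eq (i := 0) (j := 1) (by simp) ?_
      have : origRow (1 : Fin (m + 2)) = 0 := origRow_succ 0
      ext1 j
      simp [hookSummand, h₀, h₁, this]
    · refine det_eq_zero_of_block_support (I := I) (S := S) (by tauto) _ ?_ ?_
      · intro i hi j hj
        simp [hookSummand, hi, hj]
      · intro i hi j hj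
        simp [hookSummand, hi, hj]
  · exact Matrix.det_eq_zero_of_row_eq_zero 0 fun j => by simp [hookSummand, h₀]

/-- The three indicator functions add up to twice the full row, which is repeated. -/
lemma det_hookMatrix_add_add {A B C : Finset (Fin (m + 2))}
    (hAB : Disjoint A B) (hAC : Disjoint A C) (hBC : Disjoint B C)
    (hunion : A ∪ B ∪ C = Finset.univ) :
    (hookMatrix (A ∪ B)).det + (hookMatrix (A ∪ C)).det + (hookMatrix (B ∪ C)).det = 0 := by
  have hrow : ∀ S : Finset (Fin (m + 2)),
      hookMatrix S = (hookMatrix Finset.univ).updateRow 0 (hookMatrix S 0) := by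
    intro S
    ext1 i j
    by_cases hi : i = 0
    · subst hi; simp
    · simp [hi, hookMatrix]
  have hsum : hookMatrix (A ∪ B) 0 + hookMatrix (A ∪ C) 0 + hookMatrix (B ∪ C) 0 =
      (2 : MvPolynomial (Fin (m + 1) × Fin (m + 2)) ℂ) • hookMatrix Finset.univ 0 := by
    ext1 j
    have hj : j ∈ A ∪ B ∪ C := hunion ▸ Finset.mem_univ j
    clear hrow hunion
    have h₁ : j ∈ A → j ∉ B := fun h => Finset.disjoint_left.mp hAB h
    have h₂ : j ∈ A → j ∉ C := fun h => Finset.disjoint_left.mp hAC h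
    have h₃ : j ∈ B → j ∉ C := fun h => Finset.disjoint_left.mp hBC h
    by_cases a : j ∈ A <;> by_cases b : j ∈ B <;> by_cases c : j ∈ C <;>
      simp_all [hookMatrix, two_mul]
  rw [hrow (A ∪ B), hrow (A ∪ C), hrow (B ∪ C), ← Matrix.det_updateRow_add,
    ← Matrix.det_updateRow_add, hsum, Matrix.det_updateRow_smul, Matrix.updateRow_eq_self,
    Matrix.det_zero_of_row_eq (i := 0) (j := 1) (by simp), mul_zero]
  have : origRow (1 : Fin (m + 2)) = 0 := origRow_succ 0
  ext1 j
  simp [hookMatrix, this]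

end HookMatrix

section Tableau

variable {m : ℕ}

lemma colList_length {ν n d : ℕ} (T : Tab ν n d) (j : Fin d) :
    (colList T j).length = (rowsUsed T j).card := by
  have : rowsUsed T j = ((List.finRange ν).filter fun i => (T i j).isSome).toFinset := by
    ext i; simp [rowsUsed]
  rw [this, List.toFinset_card_of_nodup ((List.nodup_finRange ν).filter _), colList,
    List.length_filterMap_eq_countP, List.countP_eq_length_filter]

lemma eq_of_filterMap_eq {α β : Type*} {f g : α → Option β} {l : List α}
    (h : l.filterMap f = l.filterMap g) (hs : ∀ x ∈ l, (f x).isSome = (g x).isSome) :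
    ∀ x ∈ l, f x = g x := by
  induction l with
  | nil => simp
  | cons a l ih =>
    have ha := hs a (by simp)
    have hl := fun x hx => hs x (List.mem_cons_of_mem a hx)
    rcases hf : f a with _ | b <;> rcases hg : g a with _ | c <;>
      simp_all

/-- A column is determined by its entries and the set of rows it uses. -/
lemma eq_of_colList_eq {ν n d : ℕ} {T T' : Tab ν n d} {j : Fin d}
    (h : colList T j = colList T' j) (hs : ∀ i, (T i j).isSome = (T' i j).isSome) (i : Fin ν) :
    T i j = T' i j :=
  eq_of_filterMap_eq (f := fun i => T i j) (g := fun i => T' i j) h (fun i _ => hs i) i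
    (List.mem_finRange i)

lemma filterMap_finRange_eq_sort {ν n k : ℕ} {e : Fin ν → Fin k} (he : StrictMono e)
    {J : Finset (Fin k)} (hJ : ∀ i ∈ J, ∃ a, e a = i) {w : Fin k → Fin n}
    (hw : StrictMonoOn w J) :
    ((List.finRange ν).filterMap fun a => if e a ∈ J then some (w (e a)) else none) =
      (J.image w).sort (· ≤ ·) := by
  have hp : ((List.finRange ν).filterMap fun a =>
      if e a ∈ J then some (w (e a)) else none).Pairwise (· < ·) := by
    rw [List.pairwise_filterMap]
    refine (List.pairwise_lt_finRange ν).imp fun {a b} hab x hx y hy => ?_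
    split_ifs at hx hy with h₁ h₂
    · cases hx
      cases hy
      exact hw h₁ h₂ (he hab)
  have hn := hp.imp (fun h => ne_of_lt h)
  rw [← (List.toFinset_sort (· ≤ ·) hn).mpr (hp.imp le_of_lt)]
  congr 1
  ext x
  simp only [List.mem_toFinset, List.mem_filterMap, List.mem_finRange, true_and, Finset.mem_image]
  constructor
  · rintro ⟨a, ha⟩
    split_ifs at ha with h
    exact ⟨e a, h, by simpa using ha⟩
  · rintro ⟨i, hi, rfl⟩
    obtain ⟨a, rfl⟩ := hJ i hi
    exact ⟨a, by simp [hi]⟩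

lemma minor_image_s5 {ν n : ℕ} {I J : Finset (Fin n)} (h : I.card = J.card) {ρ : Fin n → Fin ν}
    (hρ : StrictMonoOn ρ I) :
    minor ν n (I.image ρ) J = Matrix.det (Matrix.of fun a b : Fin J.card =>
      (MvPolynomial.X (ρ (I.orderEmbOfFin h a), J.orderEmbOfFin rfl b) :
        MvPolynomial (Fin ν × Fin n) ℂ)) := by
  have hc : (I.image ρ).card = J.card := by rw [Finset.card_image_of_injOn hρ.injOn, h]
  have := Finset.orderEmbOfFin_unique hc (f := fun a => ρ (I.orderEmbOfFin h a))
    (fun a => Finset.mem_image_of_mem _ (Finset.orderEmbOfFin_mem _ _ _))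
    (fun a b hab => hρ (Finset.orderEmbOfFin_mem _ _ _) (Finset.orderEmbOfFin_mem _ _ _)
      ((I.orderEmbOfFin h).strictMono hab))
  rw [minor_eq_det hc rfl, ← this]

/-- The position in the reading word of the cell in the first column and row `k`. -/
def firstCell (k : Fin (m + 1)) : Fin (m + 2) := Fin.cases 0 (fun k => k.succ.succ) k

@[simp] lemma firstCell_zero : firstCell (0 : Fin (m + 1)) = 0 := rfl

@[simp] lemma firstCell_succ (k : Fin m) : firstCell k.succ = k.succ.succ := rfl

lemma firstCell_strictMono : StrictMono (firstCell (m := m)) := by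
  intro a b hab
  cases a using Fin.cases <;> cases b using Fin.cases <;> simp_all

lemma firstCell_ne_one (k : Fin (m + 1)) : firstCell k ≠ 1 := by
  cases k using Fin.cases with
  | zero => simp
  | succ k => exact fun h => Fin.succ_ne_zero k (Fin.succ_injective _ h)

lemma exists_firstCell_eq {i : Fin (m + 2)} (hi : i ≠ 1) : ∃ k, firstCell k = i := by
  cases i using Fin.cases with
  | zero => exact ⟨0, rfl⟩
  | succ i =>
    cases i using Fin.cases with
    | zero => exact absurd rfl hi
    | succ i => exact ⟨i.succ, rfl⟩

lemma origRow_strictMonoOn {J : Finset (Fin (m + 2))} (hJ : 0 ∈ J → 1 ∉ J) :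
    StrictMonoOn origRow (J : Set (Fin (m + 2))) := by
  intro a ha b hb hab
  cases a using Fin.cases with
  | zero =>
    cases b using Fin.cases with
    | zero => simp at hab
    | succ b =>
      refine Fin.pos_of_ne_zero fun h => hJ ha ?_
      have : b = 0 := h
      subst this
      exact hb
  | succ a =>
    cases b using Fin.cases with
    | zero => simp at hab
    | succ b => simpa using hab

/-- The two-column tableau whose reading word is `w`, with the letters in positions `I` placed
in the first column. -/
def wordTab (I : Finset (Fin (m + 2))) (w : Fin (m + 2) → Fin (m + 2)) :
    Tab (m + 1) (m + 2) 2 :=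
  fun k => ![if firstCell k ∈ I then some (w (firstCell k)) else none,
    if k.succ ∈ Iᶜ then some (w k.succ) else none]

variable {I S : Finset (Fin (m + 2))}

lemma cells_wordTab (h₀ : 0 ∈ I) (h₁ : 1 ∉ I) (w : Fin (m + 2) → Fin (m + 2)) :
    cells (wordTab I w) =
      List.ofFn fun i => ((if i ∈ I then 0 else 1 : Fin 2), w i) := by
  rw [cells, List.finRange_succ (n := m), List.flatMap_cons, List.flatMap_map, List.ofFn_succ,
    List.ofFn_succ, List.ofFn_eq_map, List.map_eq_flatMap]
  have hrow : ∀ k : Fin m, ((List.finRange 2).filterMap fun j =>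
      (wordTab I w k.succ j).map fun v => (j, v)) =
        [((if k.succ.succ ∈ I then 0 else 1 : Fin 2), w k.succ.succ)] := by
    intro k
    by_cases hk : k.succ.succ ∈ I <;>
      simp [List.finRange_succ, List.filterMap_cons, wordTab, hk]
  simp only [hrow]
  simp [List.finRange_succ, wordTab, h₀, h₁]

lemma rowsUsed_wordTab_zero (h₁ : 1 ∉ I) (w : Fin (m + 2) → Fin (m + 2)) :
    rowsUsed (wordTab I w) 0 = I.image origRow := by
  ext k
  cases k using Fin.cases <;> simp [rowsUsed, wordTab, Fin.exists_fin_succ, h₁,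
    (Fin.succ_ne_zero _).symm]

lemma rowsUsed_wordTab_one (h₀ : 0 ∈ I) (w : Fin (m + 2) → Fin (m + 2)) :
    rowsUsed (wordTab I w) 1 = Iᶜ.image origRow := by
  ext k
  cases k using Fin.cases <;> simp [rowsUsed, wordTab, Fin.exists_fin_succ, h₀]

lemma image_blockPerm (h : I.card = S.card) : I.image (blockPerm I S h) = S := by
  ext i
  obtain ⟨j, rfl⟩ := (blockPerm I S h).surjective i
  simp [blockPerm_mem]

lemma image_compl_blockPerm (h : I.card = S.card) : Iᶜ.image (blockPerm I S h) = Sᶜ := by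
  ext i
  obtain ⟨j, rfl⟩ := (blockPerm I S h).surjective i
  simp [blockPerm_mem]

lemma isJelly_wordTab (h₀ : 0 ∈ I) (h₁ : 1 ∉ I) (h : I.card = S.card) :
    IsJelly (m + 2) 2 1 ![S, Sᶜ] (wordTab I (blockPerm I S h)) := by
  refine ⟨fun (i : Fin (m + 1)) hi => ?_, fun (i : Fin (m + 1)) hi => ?_, ?_⟩
  · obtain rfl : i = 0 := Fin.ext (by simpa using hi)
    simp [Fin.forall_fin_two, wordTab, h₀, h₁]
  · cases i using Fin.cases with
    | zero => simp at hi
    | succ k =>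
      by_cases hk : k.succ.succ ∈ I
      · exact ⟨0, by simp [wordTab, hk], by simp [Fin.forall_fin_two, wordTab, hk]⟩
      · exact ⟨1, by simp [wordTab, hk], by simp [Fin.forall_fin_two, wordTab, hk]⟩
  · rw [Fin.forall_fin_two]
    constructor
    · refine (filterMap_finRange_eq_sort firstCell_strictMono
        (fun i hi => exists_firstCell_eq (ne_of_mem_of_not_mem hi h₁))
        (blockPerm_strictMonoOn h)).trans ?_
      rw [image_blockPerm]
      rfl
    · refine (filterMap_finRange_eq_sort Fin.strictMono_succ
        (fun i hi => Fin.exists_succ_eq.mpr ?_) (blockPerm_strictMonoOn_compl h)).trans ?_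
      · rintro rfl
        exact Finset.mem_compl.mp hi h₀
      · rw [image_compl_blockPerm]
        rfl

lemma term_wordTab (h₀ : 0 ∈ I) (h₁ : 1 ∉ I) (h : I.card = S.card) :
    (tabSign (wordTab I (blockPerm I S h)) : ℂ) •
      JProd ![S, Sᶜ] (wordTab I (blockPerm I S h)) = (hookSummand S I).det := by
  rw [det_of_block_support h, tabSign, cells_wordTab h₀ h₁, neg_one_pow_invList_ofFn_perm,
    JProd, Fin.prod_univ_two, rowsUsed_wordTab_zero h₁, rowsUsed_wordTab_one h₀]
  · simp only [Matrix.cons_val_zero, Matrix.cons_val_one]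
    rw [minor_image_s5 h (origRow_strictMonoOn fun _ => h₁),
      minor_image_s5 (card_compl_eq h) (origRow_strictMonoOn fun h' => by simp [h₀] at h'),
      MvPolynomial.smul_eq_C_mul, map_intCast]
    congr 3
    · ext1 a b
      simp [hookSummand]
    · ext1 a b
      have h₂ := Finset.mem_compl.mp (Iᶜ.orderEmbOfFin_mem (card_compl_eq h) a)
      have h₃ := Finset.mem_compl.mp (Sᶜ.orderEmbOfFin_mem rfl b)
      have h₄ : Iᶜ.orderEmbOfFin (card_compl_eq h) a ≠ 0 := fun h' => h₂ (h' ▸ h₀)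
      simp [hookSummand, h₂, h₃, h₄]
  · intro i hi j hj
    simp [hookSummand, hi, hj]
  · intro i hi j hj
    simp [hookSummand, hi, hj]

lemma exists_wordTab_eq {T : Tab (m + 1) (m + 2) 2} (hT : IsJelly (m + 2) 2 1 ![S, Sᶜ] T) :
    ∃ (I : Finset (Fin (m + 2))) (_ : 0 ∈ I) (_ : 1 ∉ I) (h : I.card = S.card),
      wordTab I (blockPerm I S h) = T := by
  have htop : ∀ j, (T 0 j).isSome := hT.1 (0 : Fin (m + 1)) (by simp)
  have hrow : ∀ k : Fin m, ∃! j, (T k.succ j).isSome := fun k =>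
    hT.2.1 (k.succ : Fin (m + 1)) (by simp)
  have hcol : ∀ j, colList T j = (![S, Sᶜ] j).sort (· ≤ ·) := hT.2.2
  have hmem : ∀ k, firstCell k ∈ (rowsUsed T 0).image firstCell ↔ (T k 0).isSome := fun k => by
    rw [firstCell_strictMono.injective.mem_finset_image]
    simp [rowsUsed]
  have h₀ : 0 ∈ (rowsUsed T 0).image firstCell := (hmem 0).mpr (htop 0)
  have h₁ : 1 ∉ (rowsUsed T 0).image firstCell := by
    simp [firstCell_ne_one]
  have h : ((rowsUsed T 0).image firstCell).card = S.card := by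
    rw [Finset.card_image_of_injective _ firstCell_strictMono.injective, ← colList_length, hcol]
    simp
  refine ⟨_, h₀, h₁, h, ?_⟩
  have hcol' : ∀ j, colList (wordTab _ (blockPerm _ S h)) j = (![S, Sᶜ] j).sort (· ≤ ·) :=
    (isJelly_wordTab h₀ h₁ h).2.2
  funext k j
  refine eq_of_colList_eq ((hcol' j).trans (hcol j).symm) (fun i => ?_) k
  rw [Bool.eq_iff_iff]
  revert j
  rw [Fin.forall_fin_two]
  constructor
  · rw [← hmem]
    simp [wordTab]
  · cases i using Fin.cases with
    | zero =>
      have h₁' : (Fin.succ 0 : Fin (m + 2)) ∉ (rowsUsed T 0).image firstCell := h₁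
      simp only [htop, wordTab, Matrix.cons_val_one, Finset.mem_compl, h₁', not_false_eq_true,
        if_true]
      simp
    | succ i =>
      have hi := hmem i.succ
      obtain ⟨j, hj, hu⟩ := hrow i
      rw [firstCell_succ] at hi
      have : (T i.succ 1).isSome ↔ ¬(T i.succ 0).isSome := by
        constructor
        · intro ha hb
          exact absurd ((hu _ ha).trans (hu _ hb).symm) (by simp)
        · revert hj
          revert j
          simp only [Fin.forall_fin_two]
          tauto
      rw [this, ← hi]
      by_cases hc : i.succ.succ ∈ (rowsUsed T 0).image firstCell <;>
        simp only [wordTab, Matrix.cons_val_one, Finset.mem_compl, hc] <;> simp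

/-- A two-column hook jellyfish invariant is the determinant of the generic matrix with its first
row repeated, one copy being restricted to the first block. -/
lemma jellyInv_eq_det_hookMatrix (S : Finset (Fin (m + 2))) :
    jellyInv (m + 2) 2 1 ![S, Sᶜ] = (hookMatrix S).det := by
  have hL : jellyInv (m + 2) 2 1 ![S, Sᶜ] =
      ∑ T : Tab (m + 1) (m + 2) 2 with IsJelly (m + 2) 2 1 ![S, Sᶜ] T,
        (tabSign T : ℂ) • JProd ![S, Sᶜ] T := by
    rw [Finset.sum_filter]
    rfl
  rw [hL, det_hookMatrix_eq_sum, ← Finset.sum_filter_of_ne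
    (p := fun I => 0 ∈ I ∧ 1 ∉ I ∧ I.card = S.card)
    (fun I _ hI => by_contra fun hn => hI (det_hookSummand_eq_zero hn))]
  symm
  refine Finset.sum_bij
    (fun I hI => wordTab I (blockPerm I S (Finset.mem_filter.mp hI).2.2.2)) ?_ ?_ ?_ ?_
  · intro I hI
    obtain ⟨-, h₀, h₁, h⟩ := Finset.mem_filter.mp hI
    exact Finset.mem_filter.mpr ⟨Finset.mem_univ _, isJelly_wordTab h₀ h₁ h⟩
  · intro I hI J hJ hIJ
    obtain ⟨-, hI₀, hI₁, h⟩ := Finset.mem_filter.mp hI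
    obtain ⟨-, hJ₀, hJ₁, h'⟩ := Finset.mem_filter.mp hJ
    ext i
    by_cases hi : i = 1
    · subst hi; simp [hI₁, hJ₁]
    · obtain ⟨k, rfl⟩ := exists_firstCell_eq hi
      have := congrArg Option.isSome (congrFun (congrFun hIJ k) 0)
      by_cases ha : firstCell k ∈ I <;> by_cases hb : firstCell k ∈ J <;>
        simp_all [wordTab]
  · intro T hT
    obtain ⟨I, h₀, h₁, h, rfl⟩ := exists_wordTab_eq (Finset.mem_filter.mp hT).2
    exact ⟨I, Finset.mem_filter.mpr ⟨Finset.mem_univ _, h₀, h₁, h⟩, rfl⟩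
  · intro I hI
    obtain ⟨-, h₀, h₁, h⟩ := Finset.mem_filter.mp hI
    exact (term_wordTab h₀ h₁ h).symm

end Tableau

/-- the three-term recurrence in the hook case `r = 1`:
`[(A∪B | C)]_1 + [(A∪C | B)]_1 + [(B∪C | A)]_1 = 0`. -/
theorem statement5 (n : ℕ) (A B C : Finset (Fin n))
    (hA : A.Nonempty) (hB : B.Nonempty) (hC : C.Nonempty)
    (hAB : Disjoint A B) (hAC : Disjoint A C) (hBC : Disjoint B C)
    (hunion : A ∪ B ∪ C = Finset.univ) (hCcard : C.card = 1) :
    jellyInv n 2 1 ![A ∪ B, C] + jellyInv n 2 1 ![A ∪ C, B]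
      + jellyInv n 2 1 ![B ∪ C, A] = 0 := by
  have hn : 2 ≤ n := by
    have := Finset.card_le_univ (A ∪ B)
    rw [Finset.card_union_of_disjoint hAB, Fintype.card_fin] at this
    have := hA.card_pos
    have := hB.card_pos
    omega
  obtain ⟨m, rfl⟩ := Nat.exists_eq_add_of_le' hn
  have hcompl : ∀ {X Y : Finset (Fin (m + 2))}, Disjoint X Y → X ∪ Y = Finset.univ → Y = Xᶜ :=
    fun hd hu => (IsCompl.of_eq (Finset.disjoint_iff_inter_eq_empty.mp hd) hu).compl_eq.symm
  have h₁ : C = (A ∪ B)ᶜ := hcompl (Finset.disjoint_union_left.mpr ⟨hAC, hBC⟩) hunion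
  have h₂ : B = (A ∪ C)ᶜ := hcompl (Finset.disjoint_union_left.mpr ⟨hAB, hBC.symm⟩)
    (by rw [Finset.union_right_comm, hunion])
  have h₃ : A = (B ∪ C)ᶜ := hcompl (Finset.disjoint_union_left.mpr ⟨hAB.symm, hAC.symm⟩)
    (by rw [Finset.union_comm, ← Finset.union_assoc, hunion])
  have e₁ : jellyInv (m + 2) 2 1 ![A ∪ B, C] = (hookMatrix (A ∪ B)).det := by
    rw [← jellyInv_eq_det_hookMatrix, ← h₁]
  have e₂ : jellyInv (m + 2) 2 1 ![A ∪ C, B] = (hookMatrix (A ∪ C)).det := by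
    rw [← jellyInv_eq_det_hookMatrix, ← h₂]
  have e₃ : jellyInv (m + 2) 2 1 ![B ∪ C, A] = (hookMatrix (B ∪ C)).det := by
    rw [← jellyInv_eq_det_hookMatrix, ← h₃]
  rw [e₁, e₂, e₃]
  exact det_hookMatrix_add_add hAB hAC hBC hunion

end Jellyfish
end
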